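/- arXiv:1409.4934 — 6 statements merged into one kernel-verified Lean document; each statement's English description precedes it below -/
import Mathlib

section
/- Suppose λ < 1, s > −1 and ν ≥ −1, where now p satisfies, for some constants c_1, c_2 > 0, c_1 r^{s−1} (log r)^ν ≤ p(r) ≤ c_2 r^{s−1} (log r)^ν for almost all sufficiently large r. Then every nontrivial Kneser solution of the second-order problem is singular of the first kind, i.e. there exists R ≥ a with w(r) = 0 for all r ≥ R. -/
open MeasureTheory Filter Set

/-- A Kneser solution of the second-order problem `w'' + b(r) w' = p(r) F(w)` on `[a, ∞)`:
`w` is twice differentiable, `w` and `w'` satisfy the fundamental-theorem-of-calculus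
identities on `[a, ∞)` (with `w''` locally integrable), `w ≥ 0` and `w' ≤ 0` on `[a, ∞)`,
and the equation holds for a.e. `r ≥ a` with `w r > 0`. -/
def IsKneser2 (a : ℝ) (b p : ℝ → ℝ) (F : ℝ → ℝ) (w : ℝ → ℝ) : Prop :=
  Differentiable ℝ w ∧ Differentiable ℝ (deriv w) ∧
  (∀ r, a ≤ r → IntervalIntegrable (deriv (deriv w)) volume a r) ∧
  (∀ r, a ≤ r → w r = w a + ∫ ξ in a..r, deriv w ξ) ∧
  (∀ r, a ≤ r → deriv w r = deriv w a + ∫ ξ in a..r, deriv (deriv w) ξ) ∧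
  (∀ r, a ≤ r → 0 ≤ w r ∧ deriv w r ≤ 0) ∧
  (∀ᵐ r ∂(volume.restrict (Ici a)), 0 < w r →
    deriv (deriv w) r + b r * deriv w r = p r * F (w r))

lemma crossing_aux (z z' : ℝ → ℝ) (R0 c k : ℝ) (hk : 0 < k) (hR0 : 1 ≤ R0)
    (hz : ∀ r, R0 ≤ r → HasDerivAt z (z' r) r)
    (hint : ∀ r, R0 ≤ r → ∀ t, r ≤ t → IntervalIntegrable z' volume r t)
    (hnn : ∀ r, R0 ≤ r → 0 ≤ z r)
    (hle : ∀ᵐ r, R0 ≤ r → z r < c → z' r ≤ -(k * r⁻¹)) :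
    ∀ r, R0 ≤ r → c ≤ z r := by
  have step : ∀ r, R0 ≤ r → ∀ t, r ≤ t → (∀ x, r ≤ x → x < t → z x < c) →
      z t ≤ z r - k * Real.log (t / r) := by
    intro r hr t hrt hx
    have hr0 : 0 < r := by linarith
    have h1 : ∫ x in r..t, z' x = z t - z r := by
      apply intervalIntegral.integral_eq_sub_of_hasDerivAt
      · intro x hx
        rw [uIcc_of_le hrt] at hx
        exact hz x (hr.trans hx.1)
      · exact hint r hr t hrt
    have h2 : ∫ x in r..t, -(k * x⁻¹) = -(k * Real.log (t / r)) := by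
      rw [intervalIntegral.integral_neg, intervalIntegral.integral_const_mul,
        integral_inv_of_pos hr0 (by linarith)]
    have h3 : ∫ x in r..t, z' x ≤ ∫ x in r..t, -(k * x⁻¹) := by
      apply intervalIntegral.integral_mono_ae_restrict hrt (hint r hr t hrt)
      · apply ContinuousOn.intervalIntegrable
        rw [uIcc_of_le hrt]
        intro x hx
        have : x ≠ 0 := by have := hx.1; intro h; linarith
        exact ((continuousAt_const.mul (continuousAt_inv₀ this)).neg).continuousWithinAt
      · have hne : ∀ᵐ x : ℝ, x ≠ t := by
          simp [ae_iff]
        filter_upwards [ae_restrict_of_ae hle, ae_restrict_of_ae hne,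
          ae_restrict_mem measurableSet_Icc] with x h1 h2 h3
        exact h1 (hr.trans h3.1) (hx x h3.1 (lt_of_le_of_ne h3.2 h2))
    linarith
  intro r hr
  by_contra hlt
  push Not at hlt
  have hr0 : 0 < r := by linarith
  have hall : ∀ t, r ≤ t → z t < c := by
    intro t ht
    by_contra hct
    push Not at hct
    have hcont : ContinuousOn z (Icc r t) := fun x hx =>
      (hz x (hr.trans hx.1)).continuousAt.continuousWithinAt
    have hcl : IsClosed (Icc r t ∩ z ⁻¹' Ici c) :=
      hcont.preimage_isClosed_of_isClosed isClosed_Icc isClosed_Ici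
    have hcp : IsCompact (Icc r t ∩ z ⁻¹' Ici c) :=
      isCompact_Icc.of_isClosed_subset hcl inter_subset_left
    obtain ⟨t1, ht1, hmin⟩ := hcp.exists_isLeast ⟨t, ⟨ht, le_rfl⟩, hct⟩
    have := step r hr t1 ht1.1.1 (by
      intro x hx1 hx2
      by_contra hc
      push Not at hc
      have := hmin ⟨⟨hx1, hx2.le.trans ht1.1.2⟩, hc⟩
      linarith)
    have h4 : 0 ≤ Real.log (t1 / r) := Real.log_nonneg (by
      rw [le_div_iff₀ hr0]; linarith [ht1.1.1])
    have h5 : c ≤ z t1 := ht1.2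
    nlinarith
  have hzr := hnn r hr
  set t := r * Real.exp ((z r + 1) / k) with ht
  have hrt : r ≤ t := by
    have : 1 ≤ Real.exp ((z r + 1) / k) := Real.one_le_exp (by positivity)
    nlinarith
  have h6 := step r hr t hrt (fun x hx _ => hall x hx)
  have h7 : Real.log (t / r) = (z r + 1) / k := by
    rw [ht, mul_div_cancel_left₀ _ hr0.ne', Real.log_exp]
  rw [h7, mul_div_cancel₀ _ hk.ne'] at h6
  have := hnn t (hr.trans hrt)
  linarith

lemma alg_aux (L r P x Y Xv rs B μ c₁ c Y0 z : ℝ) (hL : 1 ≤ L) (hr : 1 ≤ r)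
    (hY : 0 < Y) (hY0 : Y ≤ Y0) (hx : 0 ≤ x) (hB : 0 < B) (hc1 : 0 < c₁)
    (hz : z = r * L * x) (hzc : z < c) (hc : 0 < c) (hcc : c ≤ 1)
    (hcμ : |μ| * c ≤ c₁ / 4) (hcY : (2 + B) * c * Y0 ≤ c₁ / 4)
    (hrs : r⁻¹ ≤ rs) (hP : c₁ * rs ≤ r * L * P)
    (hXv : Xv ≤ -(P / Y) + B * rs * x) :
    (L + 1) * x + r * L * (μ * x ^ 2 / Y) + r * L * Xv ≤ -(c₁ / (2 * Y0) * r⁻¹) := by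
  have hr0 : 0 < r := by linarith
  have hri : 0 < r⁻¹ := by positivity
  have hrs0 : 0 < rs := by linarith
  have hg : 0 < r * L := by positivity
  have hz0 : 0 ≤ z := by rw [hz]; positivity
  have hYp : 0 < Y0 := by linarith
  have t1 : (L + 1) * x ≤ 2 * c * rs := by
    have : (L + 1) * x ≤ 2 * z * r⁻¹ := by
      rw [hz]
      have : 2 * (r * L * x) * r⁻¹ = 2 * L * x := by field_simp
      rw [this]; nlinarith
    have : z * r⁻¹ ≤ c * rs := mul_le_mul hzc.le hrs hri.le hc.le
    linarith
  have hY1 : 0 < Y⁻¹ := by positivity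
  have t2 : r * L * (μ * x ^ 2 / Y) ≤ c₁ / 4 * rs * Y⁻¹ := by
    have e : r * L * (μ * x ^ 2 / Y) = μ * (z * x) * Y⁻¹ := by rw [hz]; field_simp
    rw [e]
    apply mul_le_mul_of_nonneg_right _ hY1.le
    have hxr : x ≤ rs := by
      have : r * x ≤ 1 := by
        have : r * x ≤ z := by rw [hz]; nlinarith [mul_nonneg hr0.le hx]
        linarith
      have : x ≤ r⁻¹ := by
        rw [← mul_le_mul_iff_right₀ hr0, mul_inv_cancel₀ hr0.ne']; exact this
      linarith
    calc μ * (z * x) ≤ |μ| * (z * x) := mul_le_mul_of_nonneg_right (le_abs_self _) (by positivity)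
      _ ≤ |μ| * (c * rs) := by gcongr
      _ = |μ| * c * rs := by ring
      _ ≤ c₁ / 4 * rs := by gcongr
  have t3 : r * L * Xv ≤ -(c₁ * rs * Y⁻¹) + B * rs * c := by
    have h1 : r * L * Xv ≤ r * L * (-(P / Y) + B * rs * x) := mul_le_mul_of_nonneg_left hXv hg.le
    have h2 : r * L * (-(P / Y) + B * rs * x) = -(r * L * P * Y⁻¹) + B * rs * z := by
      rw [hz]; field_simp
    have h3 : c₁ * rs * Y⁻¹ ≤ r * L * P * Y⁻¹ := by gcongr
    have h4 : B * rs * z ≤ B * rs * c := by gcongr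
    linarith
  have hYY : Y0⁻¹ ≤ Y⁻¹ := by gcongr
  have t4 : (2 + B) * c ≤ c₁ / 4 * Y⁻¹ := by
    calc (2 + B) * c = (2 + B) * c * Y0 * Y0⁻¹ := by field_simp
      _ ≤ c₁ / 4 * Y⁻¹ := by gcongr
  have t5 : (2 + B) * c * rs ≤ c₁ / 4 * Y⁻¹ * rs := by gcongr
  have t6 : c₁ / (2 * Y0) * r⁻¹ ≤ c₁ / 2 * Y⁻¹ * rs := by
    calc c₁ / (2 * Y0) * r⁻¹ = c₁ / 2 * Y0⁻¹ * r⁻¹ := by field_simp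
      _ ≤ _ := by gcongr
  nlinarith

theorem second_order_singular_of_nu_ge_neg_one
    (a lam s ν B : ℝ) (ha : 1 < a) (hlam : lam < 1) (hs : -1 < s) (hν : -1 ≤ ν)
    (hB : 0 < B) (b p : ℝ → ℝ) (hb_meas : Measurable b) (hp_meas : Measurable p)
    (hb_loc : ∀ r, ∃ M, ∀ x ∈ Icc a r, |b x| ≤ M)
    (hp_loc : ∀ r, ∃ M, ∀ x ∈ Icc a r, |p x| ≤ M)
    (hp_nonneg : ∀ r, a ≤ r → 0 ≤ p r)
    (hb_bound : ∀ᶠ r in atTop, |b r| ≤ B * r ^ s)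
    (hp_sim : ∃ c₁ > (0 : ℝ), ∃ c₂ > (0 : ℝ), ∃ R : ℝ,
      ∀ᵐ r ∂(volume.restrict (Ici R)),
        c₁ * r ^ (s - 1) * Real.log r ^ ν ≤ p r ∧ p r ≤ c₂ * r ^ (s - 1) * Real.log r ^ ν)
    (w : ℝ → ℝ) (hw : IsKneser2 a b p (fun t => t ^ lam) w)
    (hnt : ∃ r, a ≤ r ∧ w r ≠ 0) :
    ∃ R, a ≤ R ∧ ∀ r, R ≤ r → w r = 0 := by
  obtain ⟨hd1, hd2, hii, -, -, hsgn, heq⟩ := hw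
  obtain ⟨c₁, hc1, c₂, hc2, R, hpR⟩ := hp_sim
  obtain ⟨R', hbR⟩ := eventually_atTop.1 hb_bound
  have hanti : AntitoneOn w (Ici a) := by
    apply antitoneOn_of_deriv_nonpos (convex_Ici a) hd1.continuous.continuousOn
      hd1.differentiableOn
    intro x hx
    rw [interior_Ici] at hx
    exact (hsgn x (le_of_lt hx)).2
  by_cases hpos : ∀ r, a ≤ r → 0 < w r
  swap
  · push Not at hpos
    obtain ⟨r, hr, hwr⟩ := hpos
    refine ⟨r, hr, fun t ht => le_antisymm ?_ (hsgn t (hr.trans ht)).1⟩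
    exact (hanti hr (hr.trans ht) ht).trans hwr
  exfalso
  set μ := (1 + lam) / 2 with hμ
  set κ := (1 - lam) / 2 with hκ
  have hκ0 : 0 < κ := by rw [hκ]; linarith
  set Y0 := w a ^ κ with hY0
  have hY0p : 0 < Y0 := Real.rpow_pos_of_pos (hpos a le_rfl) _
  obtain ⟨c, hc, hcc, hcμ, hcY⟩ : ∃ c : ℝ, 0 < c ∧ c ≤ 1 ∧ |μ| * c ≤ c₁ / 4 ∧
      (2 + B) * c * Y0 ≤ c₁ / 4 := by
    refine ⟨min 1 (min (c₁ / 4 / (|μ| + 1)) (c₁ / 4 / ((2 + B) * Y0))), ?_, min_le_left _ _, ?_, ?_⟩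
    · positivity
    · calc _ ≤ (|μ| + 1) * (c₁ / 4 / (|μ| + 1)) := by
            gcongr
            · linarith
            · exact (min_le_right _ _).trans (min_le_left _ _)
        _ = c₁ / 4 := by field_simp
    · calc _ ≤ (2 + B) * (c₁ / 4 / ((2 + B) * Y0)) * Y0 := by
            gcongr
            exact (min_le_right _ _).trans (min_le_right _ _)
        _ = c₁ / 4 := by field_simp
  set R0 := max a (max R (max R' (Real.exp 1))) with hR0
  have hR0a : a ≤ R0 := le_max_left _ _
  have hR0R : R ≤ R0 := (le_max_left _ _).trans (le_max_right _ _)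
  have hR0R' : R' ≤ R0 :=
    (le_max_left _ _).trans ((le_max_right _ _).trans (le_max_right _ _))
  have hR0e : Real.exp 1 ≤ R0 :=
    (le_max_right _ _).trans ((le_max_right _ _).trans (le_max_right _ _))
  have hL : ∀ r, R0 ≤ r → 1 ≤ Real.log r := by
    intro r hr
    rw [Real.le_log_iff_exp_le (by linarith)]
    linarith
  set D := deriv w with hD
  set z : ℝ → ℝ := fun r => -(r * Real.log r * (w r ^ (-μ) * D r)) with hz
  set z' : ℝ → ℝ := fun r => -((1 * Real.log r + r * r⁻¹) * (w r ^ (-μ) * D r) +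
    r * Real.log r * ((D r * (-μ) * w r ^ (-μ - 1)) * D r + w r ^ (-μ) * deriv D r)) with hz'
  have hzd : ∀ r, R0 ≤ r → HasDerivAt z (z' r) r := by
    intro r hr
    have hr0 : r ≠ 0 := by intro h; linarith
    have hwr := hpos r (hR0a.trans hr)
    have h1 : HasDerivAt (fun r => r * Real.log r) (1 * Real.log r + r * r⁻¹) r :=
      (hasDerivAt_id r).mul (Real.hasDerivAt_log hr0)
    have h2 : HasDerivAt (fun r => w r ^ (-μ)) (D r * (-μ) * w r ^ (-μ - 1)) r :=
      (hd1 r).hasDerivAt.rpow_const (Or.inl hwr.ne')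
    exact (h1.mul (h2.mul (hd2 r).hasDerivAt)).neg
  have hcross := crossing_aux z z' R0 c (c₁ / (2 * Y0)) (by positivity) (by linarith) hzd ?_ ?_ ?_
  rotate_left
  · intro r hr t hrt
    have hsub : ∀ x ∈ uIcc r t, R0 ≤ x := by
      intro x hx; rw [uIcc_of_le hrt] at hx; exact hr.trans hx.1
    have hwc : ∀ e : ℝ, ContinuousOn (fun r => w r ^ e) (uIcc r t) := fun e =>
      hd1.continuous.continuousOn.rpow_const
        (fun x hx => Or.inl (hpos x (hR0a.trans (hsub x hx))).ne')
    have hlc : ContinuousOn Real.log (uIcc r t) := Real.continuousOn_log.mono (by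
      intro x hx
      have := hsub x hx
      simp only [mem_compl_iff, mem_singleton_iff]
      intro h; linarith)
    have hinv : ContinuousOn (fun r : ℝ => r⁻¹) (uIcc r t) := continuousOn_inv₀.mono (by
      intro x hx
      have := hsub x hx
      simp only [mem_compl_iff, mem_singleton_iff]
      intro h; linarith)
    have hDc : ContinuousOn D (uIcc r t) := hd2.continuous.continuousOn
    have hidc : ContinuousOn (fun r : ℝ => r) (uIcc r t) := continuousOn_id
    have hD2 : IntervalIntegrable (deriv D) volume r t :=
      (hii r (hR0a.trans hr)).symm.trans (hii t (hR0a.trans (hr.trans hrt)))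
    have e : z' = fun r => (-((1 * Real.log r + r * r⁻¹) * (w r ^ (-μ) * D r) +
        r * Real.log r * ((D r * (-μ) * w r ^ (-μ - 1)) * D r))) +
        (-(r * Real.log r * w r ^ (-μ))) * deriv D r := by
      funext r; simp only [hz']; ring
    rw [e]
    apply IntervalIntegrable.add
    · apply ContinuousOn.intervalIntegrable
      exact ((((continuousOn_const.mul hlc).add (hidc.mul hinv)).mul ((hwc _).mul hDc)).add
        ((hidc.mul hlc).mul (((hDc.mul continuousOn_const).mul (hwc _)).mul hDc))).neg
    · exact hD2.continuousOn_mul (((hidc.mul hlc).mul (hwc _)).neg)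
  · intro r hr
    have h1 := (hsgn r (hR0a.trans hr)).2
    have h2 := Real.rpow_pos_of_pos (hpos r (hR0a.trans hr)) (-μ)
    have h3 := hL r hr
    have h4 : 0 < r * Real.log r := mul_pos (by linarith) (by linarith)
    have h5 : w r ^ (-μ) * D r ≤ 0 := mul_nonpos_of_nonneg_of_nonpos h2.le h1
    have h6 := mul_nonpos_of_nonneg_of_nonpos h4.le h5
    simp only [hz]; linarith
  · have heq' := (ae_restrict_iff' measurableSet_Ici).1 heq
    have hpR' := (ae_restrict_iff' measurableSet_Ici).1 hpR
    filter_upwards [heq', hpR'] with r he hpr hr hzc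
    have har : a ≤ r := hR0a.trans hr
    have hwr := hpos r har
    have he := he har hwr
    have hpr := (hpr (hR0R.trans hr)).1
    have hbr := hbR r (hR0R'.trans hr)
    have hDr := (hsgn r har).2
    have hLr := hL r hr
    have hr1 : 1 ≤ r := by linarith
    have hr0 : 0 < r := by linarith
    have hX := Real.rpow_pos_of_pos hwr (-μ)
    have hY := Real.rpow_pos_of_pos hwr κ
    have hrs0 := Real.rpow_pos_of_pos hr0 s
    have eY1 : w r ^ (-μ) * w r ^ lam = (w r ^ κ)⁻¹ := by
      rw [← Real.rpow_add hwr, ← Real.rpow_neg hwr.le]; congr 1; rw [hμ, hκ]; ring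
    have eY2 : w r ^ (-μ - 1) = (w r ^ (-μ)) ^ 2 / w r ^ κ := by
      rw [pow_two, ← Real.rpow_add hwr, ← Real.rpow_sub hwr]; congr 1; rw [hμ, hκ]; ring
    have key := alg_aux (Real.log r) r (p r) (-(w r ^ (-μ) * D r)) (w r ^ κ)
      (-(w r ^ (-μ) * deriv D r)) (r ^ s) B μ c₁ c Y0 (z r) hLr hr1 hY
      (Real.rpow_le_rpow hwr.le (hanti (mem_Ici.2 le_rfl) (mem_Ici.2 har) har) hκ0.le)
      (by have := mul_nonpos_of_nonneg_of_nonpos hX.le hDr; linarith) hB hc1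
      (by simp only [hz]; ring) hzc hc hcc hcμ hcY ?_ ?_ ?_
    · refine le_trans (le_of_eq ?_) key
      simp only [hz']
      rw [eY2, mul_inv_cancel₀ hr0.ne']
      ring
    · rw [← Real.rpow_neg_one]
      exact Real.rpow_le_rpow_of_exponent_le hr1 hs.le
    · have h1 : (Real.log r)⁻¹ ≤ Real.log r ^ ν := by
        rw [← Real.rpow_neg_one]
        exact Real.rpow_le_rpow_of_exponent_le hLr hν
      have hLp : 0 < Real.log r := by linarith
      calc c₁ * r ^ s = r * Real.log r * (c₁ * r ^ (s - 1) * (Real.log r)⁻¹) := by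
            rw [Real.rpow_sub_one hr0.ne']; field_simp
        _ ≤ r * Real.log r * (c₁ * r ^ (s - 1) * Real.log r ^ ν) := by
            have := Real.rpow_pos_of_pos hr0 (s - 1)
            gcongr
        _ ≤ _ := by gcongr
    · have e1 : deriv D r = p r * w r ^ lam - b r * D r := by linarith
      have e2 : -(w r ^ (-μ) * deriv D r) =
          -(p r / w r ^ κ) + b r * (w r ^ (-μ) * D r) := by
        rw [e1, div_eq_mul_inv, ← eY1]; ring
      rw [e2]
      have hx : w r ^ (-μ) * D r ≤ 0 := mul_nonpos_of_nonneg_of_nonpos hX.le hDr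
      have := (abs_le.1 hbr).1
      nlinarith
  -- final contradiction
  have hfin : AntitoneOn (fun r => w r ^ κ + κ * c * Real.log (Real.log r)) (Ici R0) := by
    have hder : ∀ r, R0 ≤ r → HasDerivAt (fun r => w r ^ κ + κ * c * Real.log (Real.log r))
        (D r * κ * w r ^ (κ - 1) + κ * c * (r⁻¹ / Real.log r)) r := by
      intro r hr
      have hr0 : r ≠ 0 := by intro h; linarith
      have hl0 : Real.log r ≠ 0 := by have := hL r hr; intro h; linarith
      exact ((hd1 r).hasDerivAt.rpow_const (Or.inl (hpos r (hR0a.trans hr)).ne')).add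
        (((Real.hasDerivAt_log hr0).log hl0).const_mul _)
    apply antitoneOn_of_deriv_nonpos (convex_Ici R0)
    · intro r hr; exact (hder r hr).continuousAt.continuousWithinAt
    · intro r hr
      rw [interior_Ici] at hr
      exact (hder r (le_of_lt hr)).differentiableAt.differentiableWithinAt
    · intro r hr
      rw [interior_Ici] at hr
      have hr : R0 ≤ r := le_of_lt hr
      rw [(hder r hr).deriv]
      have h1 := hcross r hr
      simp only [hz] at h1
      have hr0 : 0 < r := by linarith
      have hl0 : 0 < Real.log r := by have := hL r hr; linarith
      have e1 : κ - 1 = -μ := by rw [hκ, hμ]; ring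
      rw [e1]
      have h2 : c * (r⁻¹ / Real.log r) ≤ -(w r ^ (-μ) * D r) := by
        calc c * (r⁻¹ / Real.log r)
            ≤ -(r * Real.log r * (w r ^ (-μ) * D r)) * (r⁻¹ / Real.log r) := by gcongr
          _ = _ := by field_simp
      nlinarith
  have hlim : Tendsto (fun r => κ * c * Real.log (Real.log r)) atTop atTop :=
    (Real.tendsto_log_atTop.comp Real.tendsto_log_atTop).const_mul_atTop (by positivity)
  obtain ⟨t, ht1, ht2⟩ := ((hlim.eventually_gt_atTop
    (w R0 ^ κ + κ * c * Real.log (Real.log R0))).and (eventually_ge_atTop R0)).exists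
  have h1 := hfin (mem_Ici.2 le_rfl) (mem_Ici.2 ht2) ht2
  have h2 := Real.rpow_pos_of_pos (hpos t (hR0a.trans ht2)) κ
  simp only at h1
  linarith
end

section
/- Suppose λ > 2, s > −1 and l ≥ s − 1. Then every nontrivial Kneser solution of the second-order logarithmic problem w'' + b(r) w' = p(r) w ln^λ(1 + 1/w) is singular of the first kind, i.e. there exists R ≥ a with w(r) = 0 for all r ≥ R. -/
open MeasureTheory Filter Set

lemma aux_ftc (f f' : ℝ → ℝ) (x0 x1 C : ℝ) (h01 : x0 ≤ x1)
    (hd : ∀ x ∈ Icc x0 x1, HasDerivAt f (f' x) x)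
    (hi : IntervalIntegrable f' volume x0 x1)
    (hle : ∀ᵐ x, x ∈ Icc x0 x1 → f' x ≤ C) : f x1 - f x0 ≤ C * (x1 - x0) := by
  have h1 : ∫ y in x0..x1, f' y = f x1 - f x0 := by
    apply intervalIntegral.integral_eq_sub_of_hasDerivAt _ hi
    rwa [uIcc_of_le h01]
  rw [← h1]
  have h2 : ∫ y in x0..x1, f' y ≤ ∫ _ in x0..x1, C := by
    apply intervalIntegral.integral_mono_ae_restrict h01 hi (by simp)
    exact (ae_restrict_iff' measurableSet_Icc).2 hle
  simpa [mul_comm] using h2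

lemma aux_barrier (u u' : ℝ → ℝ) (r0 r1 M K : ℝ) (h01 : r0 ≤ r1) (hK : 0 ≤ K)
    (hd : ∀ x ∈ Icc r0 r1, HasDerivAt u (u' x) x)
    (hi : IntervalIntegrable u' volume r0 r1)
    (hM : u r0 < M)
    (hle : ∀ᵐ x, x ∈ Icc r0 r1 → u x ≤ M → u' x ≤ -K) : u r1 ≤ u r0 - K * (r1 - r0) := by
  have hcont : ContinuousOn u (Icc r0 r1) := fun x hx =>
    (hd x hx).continuousAt.continuousWithinAt
  have key : ∀ x ∈ Icc r0 r1, u x ≤ M := by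
    by_contra! hcon
    obtain ⟨x, hx, hxM⟩ := hcon
    have hcl : IsCompact (Icc r0 r1 ∩ u ⁻¹' Ici M) :=
      isCompact_Icc.of_isClosed_subset
        (hcont.preimage_isClosed_of_isClosed isClosed_Icc isClosed_Ici) inter_subset_left
    obtain ⟨t, ⟨ht, htM⟩, htl⟩ := hcl.exists_isLeast ⟨x, hx, hxM.le⟩
    have htM' : M ≤ u t := htM
    have hbelow : ∀ y ∈ Icc r0 t, y ≠ t → u y ≤ M := by
      intro y hy hyt
      by_contra! hc
      exact hyt (le_antisymm hy.2 (htl ⟨⟨hy.1, hy.2.trans ht.2⟩, hc.le⟩))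
    have hne : ∀ᵐ y : ℝ, y ≠ t := by
      simp [ae_iff]
    have := aux_ftc u u' r0 t (-K) ht.1 (fun y hy => hd y ⟨hy.1, hy.2.trans ht.2⟩)
      (hi.mono_set (by rw [uIcc_of_le ht.1, uIcc_of_le h01]; exact Icc_subset_Icc_right ht.2))
      (by
        filter_upwards [hle, hne] with y hy hy2 hy3
        exact hy ⟨hy3.1, hy3.2.trans ht.2⟩ (hbelow y hy3 hy2))
    nlinarith [ht.1]
  have := aux_ftc u u' r0 r1 (-K) h01 hd hi (by
    filter_upwards [hle] with y hy hy3
    exact hy hy3 (key y hy3))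
  linarith

lemma aux_rpow_le (s r0 r : ℝ) (h0 : 0 < r0) (h1 : r0 ≤ r) (h2 : r ≤ 2 * r0) :
    r ^ s ≤ 2 ^ |s| * r0 ^ s := by
  have hr : 0 < r := by linarith
  have e : r ^ s = (r / r0) ^ s * r0 ^ s := by
    rw [← Real.mul_rpow (by positivity) h0.le]; congr 1; field_simp
  rw [e]
  gcongr
  have hq : 1 ≤ r / r0 := by rw [le_div_iff₀ h0]; linarith
  have hq2 : r / r0 ≤ 2 := by rw [div_le_iff₀ h0]; linarith
  calc (r / r0) ^ s ≤ (r / r0) ^ |s| := Real.rpow_le_rpow_of_exponent_le hq (le_abs_self s)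
    _ ≤ 2 ^ |s| := Real.rpow_le_rpow (by positivity) hq2 (abs_nonneg s)

lemma aux_le_rpow (s r0 r : ℝ) (h0 : 0 < r0) (h1 : r0 ≤ r) (h2 : r ≤ 2 * r0) :
    (2 ^ |s|)⁻¹ * r0 ^ s ≤ r ^ s := by
  have hr : 0 < r := by linarith
  have h := aux_rpow_le (-s) r0 r h0 h1 h2
  rw [Real.rpow_neg hr.le, Real.rpow_neg h0.le, abs_neg] at h
  have p1 : 0 < r ^ s := Real.rpow_pos_of_pos hr s
  have p2 : 0 < r0 ^ s := Real.rpow_pos_of_pos h0 s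
  have p3 : (0:ℝ) < 2 ^ |s| := Real.rpow_pos_of_pos (by norm_num) _
  rw [← div_eq_mul_inv, inv_eq_one_div, div_le_div_iff₀ p1 p2] at h
  rw [inv_mul_le_iff₀ p3]
  linarith

/-- Blow-up of `Y' ≥ e Y^μ / r`. -/
lemma aux_blowup (Y Y' : ℝ → ℝ) (R e μ : ℝ) (hR : 0 < R) (he : 0 < e) (hμ : 1 < μ)
    (hY : ∀ r, R ≤ r → 0 < Y r) (hd : ∀ r, R ≤ r → HasDerivAt Y (Y' r) r)
    (hle : ∀ r, R ≤ r → e * r⁻¹ * Y r ^ μ ≤ Y' r) : False := by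
  have hder : ∀ r, R ≤ r → HasDerivAt (fun r => Y r ^ (1 - μ) + (μ - 1) * e * Real.log r)
      (Y' r * (1 - μ) * Y r ^ (1 - μ - 1) + (μ - 1) * e * r⁻¹) r := by
    intro r hr
    exact ((hd r hr).rpow_const (Or.inl (hY r hr).ne')).add
      ((Real.hasDerivAt_log (by linarith : (0:ℝ) < r).ne').const_mul _)
  have hanti : AntitoneOn (fun r => Y r ^ (1 - μ) + (μ - 1) * e * Real.log r) (Ici R) := by
    apply antitoneOn_of_hasDerivWithinAt_nonpos (convex_Ici R)
      (fun r hr => (hder r hr).continuousAt.continuousWithinAt)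
      (fun r hr => (hder r (interior_subset hr)).hasDerivWithinAt)
    intro r hr
    have hr' : R ≤ r := interior_subset hr
    have hp := hY r hr'
    have h1 : Y r ^ (1 - μ - 1) = (Y r ^ μ)⁻¹ := by
      rw [← Real.rpow_neg hp.le]; congr 1; ring
    have h2 : 0 < Y r ^ μ := Real.rpow_pos_of_pos hp _
    have h3 : e * r⁻¹ ≤ Y' r * (Y r ^ μ)⁻¹ := by
      rw [← div_eq_mul_inv (Y' r), le_div_iff₀ h2]; exact hle r hr'
    rw [h1]
    nlinarith
  have ht : Tendsto (fun r => (μ - 1) * e * Real.log r) atTop atTop :=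
    Real.tendsto_log_atTop.const_mul_atTop (by nlinarith)
  obtain ⟨r, h1, h2⟩ := ((ht.eventually_gt_atTop
    (Y R ^ (1 - μ) + (μ - 1) * e * Real.log R)).and (eventually_ge_atTop R)).exists
  have h3 := hanti (self_mem_Ici) h2 h2
  simp only at h3
  have h4 : 0 < Y r ^ (1 - μ) := Real.rpow_pos_of_pos (hY r h2) _
  linarith

set_option maxHeartbeats 2000000 in
/-- Example 2.3 (case `s > -1`): if `λ > 2`, `s > -1`, `l ≥ s - 1`, `|b(r)| ≤ B r^s` for
large `r` and `p(r) ∼ r^l` at infinity, then every non-trivial Kneser solution of the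
logarithmic problem `w'' + b(r) w' = p(r) w ln^λ(1 + 1/w)` is singular of the first kind. -/
theorem second_order_log_singular_of_l_ge_s_sub_one
    (a lam s l B : ℝ) (ha : 0 < a) (hlam : 2 < lam) (hs : -1 < s) (hl : s - 1 ≤ l)
    (hB : 0 < B) (b p : ℝ → ℝ) (hb_meas : Measurable b) (hp_meas : Measurable p)
    (hb_loc : ∀ r, ∃ M, ∀ x ∈ Icc a r, |b x| ≤ M)
    (hp_loc : ∀ r, ∃ M, ∀ x ∈ Icc a r, |p x| ≤ M)
    (hp_nonneg : ∀ r, a ≤ r → 0 ≤ p r)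
    (hb_bound : ∀ᶠ r in atTop, |b r| ≤ B * r ^ s)
    (hp_sim : ∃ c₁ > (0 : ℝ), ∃ c₂ > (0 : ℝ), ∃ R : ℝ,
      ∀ᵐ r ∂(volume.restrict (Ici R)), c₁ * r ^ l ≤ p r ∧ p r ≤ c₂ * r ^ l)
    (w : ℝ → ℝ)
    (hw : IsKneser2 a b p (fun t => t * Real.log (1 + 1 / t) ^ lam) w)
    (hnt : ∃ r, a ≤ r ∧ w r ≠ 0) :
    ∃ R, a ≤ R ∧ ∀ r, R ≤ r → w r = 0 := by
  obtain ⟨hd1, hd2, hint, -, -, hsgn, heq⟩ := hw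
  have hanti : AntitoneOn w (Ici a) := by
    apply antitoneOn_of_deriv_nonpos (convex_Ici a) hd1.continuous.continuousOn
      hd1.differentiableOn
    intro x hx
    exact (hsgn x (interior_subset hx)).2
  by_contra hcon
  push Not at hcon
  have hpos : ∀ r, a ≤ r → 0 < w r := by
    intro r hr
    obtain ⟨t, ht, htw⟩ := hcon r hr
    have h1 := (hsgn t (hr.trans ht)).1
    have h2 := hanti hr (show t ∈ Ici a from hr.trans ht) ht
    have h3 : 0 < w t := lt_of_le_of_ne h1 htw.symm
    linarith
  clear hcon hnt
  obtain ⟨c₁, hc₁, c₂, -, R₂, hp⟩ := hp_sim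
  obtain ⟨R₁, hb⟩ := eventually_atTop.1 hb_bound
  set R := max (max a 1) (max R₁ R₂) with hRdef
  have hRa : a ≤ R := (le_max_left _ _).trans (le_max_left _ _)
  have hR1 : 1 ≤ R := (le_max_right _ _).trans (le_max_left _ _)
  have hRR1 : R₁ ≤ R := (le_max_left _ _).trans (le_max_right _ _)
  have hRR2 : R₂ ≤ R := (le_max_right _ _).trans (le_max_right _ _)
  clear_value R
  rw [ae_restrict_iff' measurableSet_Ici] at heq hp
  set u : ℝ → ℝ := fun r => -deriv w r / w r with hu
  set u' : ℝ → ℝ := fun r => -deriv (deriv w) r * (w r)⁻¹ + (deriv w r / w r) ^ 2 with hu'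
  set Y : ℝ → ℝ := fun r => Real.log (1 + 1 / w r) with hYdef
  have hu0 : ∀ r, a ≤ r → 0 ≤ u r := fun r hr =>
    div_nonneg (by linarith [(hsgn r hr).2]) (hpos r hr).le
  have hYpos : ∀ r, a ≤ r → 0 < Y r := fun r hr => by
    have := hpos r hr
    apply Real.log_pos
    have : 0 < 1 / w r := by positivity
    linarith
  have hYmono : ∀ r t, a ≤ r → r ≤ t → Y r ≤ Y t := by
    intro r t hr hrt
    have h1 := hpos r hr
    have h2 := hpos t (hr.trans hrt)
    have h3 := hanti hr (show t ∈ Ici a from hr.trans hrt) hrt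
    apply Real.log_le_log (by positivity)
    gcongr
  have hud : ∀ r, a ≤ r → HasDerivAt u (u' r) r := by
    intro r hr
    have h1 := hpos r hr
    have h := ((hd2 r).hasDerivAt.neg).div (hd1 r).hasDerivAt h1.ne'
    refine HasDerivAt.congr_deriv (f := u) h ?_
    simp only [hu', Pi.neg_apply]
    field_simp
    ring
  have hYd : ∀ r, a ≤ r → HasDerivAt Y (u r / (1 + w r)) r := by
    intro r hr
    have h1 := hpos r hr
    have h := ((((hd1 r).hasDerivAt.inv h1.ne').const_add 1)).log
      (by have e2 : w⁻¹ r = (w r)⁻¹ := rfl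
          rw [e2]; positivity)
    have e : Y = fun y => Real.log (1 + w⁻¹ y) := by
      funext y; simp [hYdef]
    rw [e]
    convert h using 1
    have e2 : w⁻¹ r = (w r)⁻¹ := rfl
    rw [e2]
    simp only [hu]
    field_simp
    try ring
  have hui : ∀ r t, a ≤ r → r ≤ t → IntervalIntegrable u' volume r t := by
    intro r t hr hrt
    have hpos' : ∀ x ∈ uIcc r t, w x ≠ 0 := by
      intro x hx
      rw [uIcc_of_le hrt] at hx
      exact (hpos x (hr.trans hx.1)).ne'
    have i1 : IntervalIntegrable (deriv (deriv w)) volume r t :=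
      (hint r hr).symm.trans (hint t (hr.trans hrt))
    apply IntervalIntegrable.add
    · exact i1.neg.mul_continuousOn (hd1.continuous.continuousOn.inv₀ hpos')
    · apply ContinuousOn.intervalIntegrable
      exact (hd2.continuous.continuousOn.div hd1.continuous.continuousOn hpos').pow 2
  have hric : ∀ᵐ r, R ≤ r → u' r ≤ u r ^ 2 + B * r ^ s * u r - c₁ * r ^ l * Y r ^ lam := by
    filter_upwards [heq, hp] with r h1 h2 hr
    have hra := hRa.trans hr
    have hw := hpos r hra
    have h1 := h1 hra hw
    have h2 := (h2 (hRR2.trans hr)).1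
    have h3 := hb r (hRR1.trans hr)
    have hY : 0 ≤ Y r ^ lam := (Real.rpow_pos_of_pos (hYpos r hra) _).le
    have e : u' r = u r ^ 2 - b r * u r - p r * Y r ^ lam := by
      have : deriv (deriv w) r = p r * (w r * Y r ^ lam) - b r * deriv w r := by
        simp only [hYdef]; linarith
      simp only [hu', hu, this]
      field_simp
      ring
    rw [e]
    have h4 : -(b r) ≤ B * r ^ s := (neg_le_abs _).trans h3
    have h5 := mul_le_mul_of_nonneg_right h4 (hu0 r hra)
    have h6 := mul_le_mul_of_nonneg_right h2 hY
    linarith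
  set Cs : ℝ := 2 ^ |s| with hCs
  have hCs0 : 0 < Cs := Real.rpow_pos_of_pos (by norm_num) _
  have hcl0 : (0:ℝ) < (2 ^ |l|)⁻¹ := inv_pos.2 (Real.rpow_pos_of_pos (by norm_num) _)
  set k : ℝ := c₁ * (2 ^ |l|)⁻¹ / 2 with hk
  have hk0 : 0 < k := by positivity
  set z : ℝ := Y a ^ (lam / 2) with hz
  have hz0 : 0 < z := Real.rpow_pos_of_pos (hYpos a le_rfl) _
  obtain ⟨ε, hε0, hε1, hε2, hε3⟩ : ∃ ε : ℝ, 0 < ε ∧ ε ≤ 1 ∧ ε * (1 + B * Cs / z) ≤ k ∧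
      ε ≤ k * z := by
    have hq : 0 < 1 + B * Cs / z := by positivity
    refine ⟨min 1 (min (k / (1 + B * Cs / z)) (k * z)), by positivity, min_le_left _ _, ?_, ?_⟩
    · rw [← le_div_iff₀ hq]
      exact (min_le_right _ _).trans (min_le_left _ _)
    · exact (min_le_right _ _).trans (min_le_right _ _)
  have hmain : ∀ r, R ≤ r → ε * r⁻¹ * Y r ^ (lam / 2) ≤ u r := by
    intro r0 hr0
    by_contra! hlt
    have hra : a ≤ r0 := hRa.trans hr0
    have h1r : 1 ≤ r0 := hR1.trans hr0
    have hr0p : 0 < r0 := by linarith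
    set Z := Y r0 ^ (lam / 2) with hZ
    have hzZ : z ≤ Z := Real.rpow_le_rpow (hYpos a le_rfl).le (hYmono a r0 le_rfl hra)
      (by linarith)
    have hZ0 : 0 < Z := hz0.trans_le hzZ
    have hZ2 : Z ^ 2 = Y r0 ^ lam := by
      rw [hZ, ← Real.rpow_natCast, ← Real.rpow_mul (hYpos r0 hra).le]
      congr 1; push_cast; ring
    set P := r0 ^ l with hP
    have hP0 : 0 < P := Real.rpow_pos_of_pos hr0p _
    have hP2 : (r0⁻¹) ^ 2 ≤ P := by
      have : (r0⁻¹) ^ 2 = r0 ^ (-2 : ℝ) := by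
        rw [Real.rpow_neg hr0p.le]; norm_num
      rw [this]
      exact Real.rpow_le_rpow_of_exponent_le h1r (by linarith)
    have hPs : r0 ^ s * r0⁻¹ ≤ P := by
      rw [← Real.rpow_neg_one r0, ← Real.rpow_add hr0p]
      exact Real.rpow_le_rpow_of_exponent_le h1r (by linarith)
    have hP1 : r0⁻¹ ≤ P * r0 := by
      have := mul_le_mul_of_nonneg_right hP2 hr0p.le
      have e : (r0⁻¹) ^ 2 * r0 = r0⁻¹ := by field_simp
      rwa [e] at this
    have hbar := aux_barrier u u' r0 (2 * r0) (ε * r0⁻¹ * Z) (k * P * Z ^ 2) (by linarith)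
      (by positivity) (fun x hx => hud x (hra.trans hx.1)) (hui _ _ hra (by linarith)) hlt
      (by
        filter_upwards [hric] with x hx hxm hxM
        have hx := hx (hr0.trans hxm.1)
        have hxa := hra.trans hxm.1
        have hx0 : 0 < x := by linarith
        have hux := hu0 x hxa
        have a1 : u x ^ 2 ≤ (ε * r0⁻¹ * Z) ^ 2 := pow_le_pow_left₀ hux hxM 2
        have a2 : B * x ^ s * u x ≤ B * (Cs * r0 ^ s) * (ε * r0⁻¹ * Z) := by
          have := aux_rpow_le s r0 x hr0p hxm.1 hxm.2
          have := Real.rpow_pos_of_pos hr0p s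
          gcongr
        have a3 : c₁ * ((2 ^ |l|)⁻¹ * P) * Z ^ 2 ≤ c₁ * x ^ l * Y x ^ lam := by
          have h1 := aux_le_rpow l r0 x hr0p hxm.1 hxm.2
          have h2 : Z ^ 2 ≤ Y x ^ lam := by
            rw [hZ2]
            exact Real.rpow_le_rpow (hYpos r0 hra).le (hYmono r0 x hra hxm.1) (by linarith)
          have h3 := Real.rpow_pos_of_pos hx0 l
          gcongr
        have b1 : (ε * r0⁻¹ * Z) ^ 2 ≤ ε * (P * Z ^ 2) := by
          have : ε ^ 2 ≤ ε := by rw [pow_two]; exact mul_le_of_le_one_left hε0.le hε1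
          calc (ε * r0⁻¹ * Z) ^ 2 = ε ^ 2 * ((r0⁻¹) ^ 2 * Z ^ 2) := by ring
            _ ≤ ε * (P * Z ^ 2) := by gcongr
        have b2 : B * (Cs * r0 ^ s) * (ε * r0⁻¹ * Z) ≤ ε * (B * Cs / z) * (P * Z ^ 2) := by
          have hZz : Z ≤ Z ^ 2 / z := by
            rw [le_div_iff₀ hz0, pow_two]; exact mul_le_mul_of_nonneg_left hzZ hZ0.le
          calc B * (Cs * r0 ^ s) * (ε * r0⁻¹ * Z) = ε * (B * Cs) * ((r0 ^ s * r0⁻¹) * Z) := by ring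
            _ ≤ ε * (B * Cs) * (P * (Z ^ 2 / z)) := by gcongr
            _ = _ := by ring
        have b3 : ε * (1 + B * Cs / z) * (P * Z ^ 2) ≤ k * (P * Z ^ 2) := by gcongr
        have b4 : c₁ * ((2 ^ |l|)⁻¹ * P) * Z ^ 2 = 2 * (k * (P * Z ^ 2)) := by
          rw [hk]; ring
        linarith)
    have hfin := hu0 (2 * r0) (by linarith)
    have c1 : ε * r0⁻¹ * Z ≤ k * P * Z ^ 2 * (2 * r0 - r0) := by
      calc ε * r0⁻¹ * Z ≤ (k * z) * (P * r0) * Z := by gcongr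
        _ ≤ (k * Z) * (P * r0) * Z := by gcongr
        _ = _ := by ring
    linarith
  have hwa := hpos a le_rfl
  refine aux_blowup Y (fun r => u r / (1 + w r)) R (ε / (1 + w a)) (lam / 2) (by linarith)
    (by positivity) (by linarith) (fun r hr => hYpos r (hRa.trans hr))
    (fun r hr => hYd r (hRa.trans hr)) ?_
  intro r hr
  have hra := hRa.trans hr
  have h1 := hpos r hra
  have h2 := hanti (show a ∈ Ici a from self_mem_Ici) (show r ∈ Ici a from hra) hra
  calc ε / (1 + w a) * r⁻¹ * Y r ^ (lam / 2) = (ε * r⁻¹ * Y r ^ (lam / 2)) / (1 + w a) := by ring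
    _ ≤ u r / (1 + w a) := by gcongr; exact hmain r hr
    _ ≤ u r / (1 + w r) := by
      have := hu0 r hra
      gcongr
end

section
/- Suppose λ > 1, s > −1 and l > s − 1. Then there exists a constant C > 0, independent of the solution, such that every Kneser solution w of the second-order problem satisfies w(r) ≤ C r^{(l−s+1)/(1−λ)} for all sufficiently large r. -/
open MeasureTheory Filter Set

lemma maxprin (u v x0 δ M lam : ℝ) (hx0 : x0 ∈ Ioo u v) (hδ : 0 < δ) (hlam : 1 < lam) (hM : 0 ≤ M)
    (b p w φ φ1 φ2 : ℝ → ℝ) (hw : Differentiable ℝ w) (hw' : Differentiable ℝ (deriv w))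
    (hint : IntervalIntegrable (deriv (deriv w)) volume u v)
    (hφ : ∀ r ∈ Ioo u v, HasDerivAt φ (φ1 r) r)
    (hφ1 : ∀ r ∈ Ioo u v, HasDerivAt φ1 (φ2 r) r)
    (hφ2 : ContinuousOn φ2 (Ioo u v))
    (hφpos : ∀ r ∈ Ioo u v, 0 < φ r)
    (hpos : φ x0 < w x0)
    (hb : ∀ r ∈ Ioo u v, |b r| ≤ M)
    (hp : ∀ r ∈ Ioo u v, 0 ≤ p r)
    (heq : ∀ᵐ r, r ∈ Ioo u v → 0 < w r →
      deriv (deriv w) r + b r * deriv w r = p r * (w r) ^ lam)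
    (hsup : ∀ᵐ r, r ∈ Ioo u v → φ2 r + M * |φ1 r| + δ ≤ p r * (φ r) ^ lam)
    (hmax : IsLocalMax (fun r => w r - φ r) x0) : False := by
  have hder : ∀ r ∈ Ioo u v, HasDerivAt (fun r => w r - φ r) (deriv w r - φ1 r) r :=
    fun r hr => (hw r).hasDerivAt.sub (hφ r hr)
  have h0 : deriv w x0 - φ1 x0 = 0 := hmax.hasDerivAt_eq_zero (hder x0 hx0)
  have hder1 : ∀ r ∈ Ioo u v,
      HasDerivAt (fun r => deriv w r - φ1 r) (deriv (deriv w) r - φ2 r) r :=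
    fun r hr => (hw' r).hasDerivAt.sub (hφ1 r hr)
  have hM1 : 0 < M + 1 := by linarith
  have e1 : ∀ᶠ r in nhds x0, |deriv w r - φ1 r| < δ / (2 * (M + 1)) := by
    have hc : ContinuousAt (fun r => |deriv w r - φ1 r|) x0 :=
      (hder1 x0 hx0).continuousAt.abs
    apply hc.eventually_lt_const
    simp only [h0, abs_zero]
    positivity
  have e2 : ∀ᶠ r in nhds x0, φ r < w r :=
    (hφ x0 hx0).continuousAt.eventually_lt (hw x0).continuousAt hpos
  have e3 : ∀ᶠ r in nhds x0, r ∈ Ioo u v := Ioo_mem_nhds hx0.1 hx0.2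
  obtain ⟨ε, hε, hball⟩ := Metric.eventually_nhds_iff.1 (e1.and (e2.and (e3.and hmax)))
  have hnb : ∀ r ∈ Icc x0 (x0 + ε / 2), |deriv w r - φ1 r| < δ / (2 * (M + 1)) ∧ φ r < w r ∧
      r ∈ Ioo u v ∧ w r - φ r ≤ w x0 - φ x0 := by
    intro r hr
    apply hball
    rw [Real.dist_eq, abs_lt]
    constructor <;> linarith [hr.1, hr.2]
  have hlow : ∀ᵐ r, r ∈ Icc x0 (x0 + ε / 2) → δ / 2 ≤ deriv (deriv w) r - φ2 r := by
    filter_upwards [heq, hsup] with r h1 h2 hr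
    obtain ⟨ha, hb1, hc, -⟩ := hnb r hr
    have hfp := hφpos r hc
    have h1 := h1 hc (hfp.trans hb1)
    have h2 := h2 hc
    have h3 : p r * φ r ^ lam ≤ p r * w r ^ lam :=
      mul_le_mul_of_nonneg_left (Real.rpow_le_rpow hfp.le hb1.le (by linarith)) (hp r hc)
    have h4 : b r * φ1 r ≤ M * |φ1 r| := by
      calc b r * φ1 r ≤ |b r * φ1 r| := le_abs_self _
        _ = |b r| * |φ1 r| := abs_mul _ _
        _ ≤ _ := mul_le_mul_of_nonneg_right (hb r hc) (abs_nonneg _)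
    have h5 : b r * (deriv w r - φ1 r) ≤ δ / 2 := by
      calc b r * (deriv w r - φ1 r) ≤ |b r * (deriv w r - φ1 r)| := le_abs_self _
        _ = |b r| * |deriv w r - φ1 r| := abs_mul _ _
        _ ≤ (M + 1) * (δ / (2 * (M + 1))) :=
          mul_le_mul (by linarith [hb r hc]) ha.le (abs_nonneg _) hM1.le
        _ = δ / 2 := by field_simp
    nlinarith
  have hderpos : ∀ r ∈ Ioo x0 (x0 + ε / 2), 0 < deriv w r - φ1 r := by
    intro r hr
    have hsub : Icc x0 r ⊆ Ioo u v := fun y hy =>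
      (hnb y ⟨hy.1, hy.2.trans hr.2.le⟩).2.2.1
    have hi : IntervalIntegrable (fun y => deriv (deriv w) y - φ2 y) volume x0 r := by
      apply IntervalIntegrable.sub
      · apply hint.mono_set
        rw [uIcc_of_le hr.1.le, uIcc_of_le (hx0.1.trans hx0.2).le]
        exact hsub.trans Ioo_subset_Icc_self
      · apply ContinuousOn.intervalIntegrable
        rw [uIcc_of_le hr.1.le]
        exact hφ2.mono hsub
    have hF := intervalIntegral.integral_eq_sub_of_hasDerivAt
      (f := fun r => deriv w r - φ1 r) (a := x0) (b := r)
      (fun y hy => hder1 y (hsub (by rwa [uIcc_of_le hr.1.le] at hy))) hi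
    have hG : ∫ y in x0..r, (δ / 2) ≤ ∫ y in x0..r, (deriv (deriv w) y - φ2 y) := by
      apply intervalIntegral.integral_mono_ae_restrict hr.1.le (by simp) hi
      rw [Filter.EventuallyLE, ae_restrict_iff' measurableSet_Icc]
      filter_upwards [hlow] with y hy hy2
      exact hy ⟨hy2.1, hy2.2.trans hr.2.le⟩
    rw [intervalIntegral.integral_const, smul_eq_mul] at hG
    have := mul_pos (sub_pos.2 hr.1) (half_pos hδ)
    linarith
  have hmono : StrictMonoOn (fun r => w r - φ r) (Icc x0 (x0 + ε / 2)) := by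
    apply strictMonoOn_of_deriv_pos (convex_Icc _ _)
    · exact fun y hy => (hder y (hnb y hy).2.2.1).continuousAt.continuousWithinAt
    · intro y hy
      rw [interior_Icc] at hy
      rw [(hder y (hnb y (Ioo_subset_Icc_self hy)).2.2.1).deriv]
      exact hderpos y hy
  have hend : x0 + ε / 2 ∈ Icc x0 (x0 + ε / 2) := ⟨by linarith, le_rfl⟩
  have := hmono (left_mem_Icc.2 (by linarith)) hend (by linarith)
  have h2 := (hnb _ hend).2.2.2
  simp only at this
  linarith

/-- the parabola -/
noncomputable def qq (R r : ℝ) : ℝ := (r / R - 1) * (3 - r / R)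

lemma qq_deriv (R r : ℝ) : HasDerivAt (qq R) ((4 - 2 * (r / R)) / R) r := by
  unfold qq
  have h : HasDerivAt (fun r : ℝ => r / R) (1 / R) r := (hasDerivAt_id r).div_const R
  refine ((h.sub_const 1).mul (h.const_sub 3)).congr_deriv ?_
  ring

lemma qq_pos {R r : ℝ} (hR : 0 < R) (hr : r ∈ Ioo R (3 * R)) : 0 < qq R r := by
  have h1 : 1 < r / R := by rw [lt_div_iff₀ hR]; linarith [hr.1]
  have h2 : r / R < 3 := by rw [div_lt_iff₀ hR]; linarith [hr.2]
  unfold qq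
  exact mul_pos (by linarith) (by linarith)

lemma qq_le {R r : ℝ} : qq R r ≤ 1 := by
  unfold qq
  nlinarith [sq_nonneg (r / R - 2)]

lemma barrier_deriv1 (A m R r : ℝ) (hR : 0 < R) (hr : r ∈ Ioo R (3 * R)) :
    HasDerivAt (fun r => A * qq R r ^ (-m))
      (A * ((4 - 2 * (r / R)) / R * (-m) * qq R r ^ (-m - 1))) r :=
  ((qq_deriv R r).rpow_const (Or.inl (qq_pos hR hr).ne')).const_mul A

lemma barrier_deriv2 (A m R r : ℝ) (hR : 0 < R) (hr : r ∈ Ioo R (3 * R)) :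
    HasDerivAt (fun r => A * ((4 - 2 * (r / R)) / R * (-m) * qq R r ^ (-m - 1)))
      (A * (m * (m + 1) * ((4 - 2 * (r / R)) / R) ^ 2 * qq R r ^ (-m - 2)
        + 2 * m / R ^ 2 * qq R r ^ (-m - 1))) r := by
  have h : HasDerivAt (fun r : ℝ => r / R) (1 / R) r := (hasDerivAt_id r).div_const R
  have h1 := (((h.const_mul 2).const_sub 4).div_const R).mul_const (-m)
  have h2 := (qq_deriv R r).rpow_const (p := -m - 1) (Or.inl (qq_pos hR hr).ne')
  refine ((h1.mul h2).const_mul A).congr_deriv ?_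
  rw [show -m - 1 - 1 = -m - 2 by ring]
  field_simp
  ring

lemma barrier_bound (A m R r M : ℝ) (hA : 0 < A) (hm : 0 < m) (hR : 0 < R) (hM : 0 ≤ M)
    (hr : r ∈ Ioo R (3 * R)) :
    (A * (m * (m + 1) * ((4 - 2 * (r / R)) / R) ^ 2 * qq R r ^ (-m - 2)
        + 2 * m / R ^ 2 * qq R r ^ (-m - 1)))
      + M * |A * ((4 - 2 * (r / R)) / R * (-m) * qq R r ^ (-m - 1))|
      ≤ A * qq R r ^ (-m - 2) * ((4 * m ^ 2 + 6 * m) / R ^ 2 + 2 * m * M / R) := by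
  have hq := qq_pos hR hr
  have h1 : 1 < r / R := by rw [lt_div_iff₀ hR]; linarith [hr.1]
  have h2 : r / R < 3 := by rw [div_lt_iff₀ hR]; linarith [hr.2]
  have hle : qq R r ^ (-m - 1) ≤ qq R r ^ (-m - 2) :=
    Real.rpow_le_rpow_of_exponent_ge hq qq_le (by linarith)
  have hp1 : 0 < qq R r ^ (-m - 1) := Real.rpow_pos_of_pos hq _
  have hp2 : 0 < qq R r ^ (-m - 2) := Real.rpow_pos_of_pos hq _
  set P := qq R r ^ (-m - 1)
  set Q := qq R r ^ (-m - 2)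
  have habs : |(4 - 2 * (r / R)) / R| ≤ 2 / R := by
    rw [abs_div, abs_of_pos hR]
    gcongr
    rw [abs_le]; constructor <;> linarith
  have hsq : ((4 - 2 * (r / R)) / R) ^ 2 ≤ (2 / R) ^ 2 := by
    rw [← sq_abs]; gcongr
  have e : |A * ((4 - 2 * (r / R)) / R * (-m) * P)| = A * (|(4 - 2 * (r / R)) / R| * m * P) := by
    rw [abs_mul, abs_mul, abs_mul, abs_neg, abs_of_pos hA, abs_of_pos hm, abs_of_pos hp1]
  rw [e]
  calc _ ≤ A * (m * (m + 1) * (2 / R) ^ 2 * Q + 2 * m / R ^ 2 * Q) + M * (A * (2 / R * m * Q)) := by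
        gcongr
    _ = _ := by field_simp; ring

lemma rpow_up {x s : ℝ} (h1 : 1 ≤ x) (h3 : x ≤ 3) : x ^ s ≤ 3 ^ |s| :=
  (Real.rpow_le_rpow_of_exponent_le h1 (le_abs_self s)).trans
    (Real.rpow_le_rpow (by linarith) h3 (abs_nonneg s))

lemma rpow_down {x s : ℝ} (h1 : 1 ≤ x) (h3 : x ≤ 3) : ((3 : ℝ) ^ |s|)⁻¹ ≤ x ^ s := by
  have h := rpow_up (s := -s) h1 h3
  rw [abs_neg, Real.rpow_neg (by linarith)] at h
  have hx : 0 < x ^ s := Real.rpow_pos_of_pos (by linarith) _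
  exact inv_le_of_inv_le₀ hx h

theorem second_order_upper_estimate
    (a lam s l B : ℝ) (ha : 0 < a) (hlam : 1 < lam) (hs : -1 < s) (hl : s - 1 < l)
    (hB : 0 < B) (b p : ℝ → ℝ) (hb_meas : Measurable b) (hp_meas : Measurable p)
    (hb_loc : ∀ r, ∃ M, ∀ x ∈ Icc a r, |b x| ≤ M)
    (hp_loc : ∀ r, ∃ M, ∀ x ∈ Icc a r, |p x| ≤ M)
    (hp_nonneg : ∀ r, a ≤ r → 0 ≤ p r)
    (hb_bound : ∀ᶠ r in atTop, |b r| ≤ B * r ^ s)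
    (hp_sim : ∃ c₁ > (0 : ℝ), ∃ c₂ > (0 : ℝ), ∃ R : ℝ,
      ∀ᵐ r ∂(volume.restrict (Ici R)), c₁ * r ^ l ≤ p r ∧ p r ≤ c₂ * r ^ l) :
    ∃ C, 0 < C ∧ ∀ w : ℝ → ℝ, IsKneser2 a b p (fun t => t ^ lam) w →
      ∀ᶠ r in atTop, w r ≤ C * r ^ ((l - s + 1) / (1 - lam)) := by
  obtain ⟨c1, hc1, c2, hc2, R1, hp1⟩ := hp_sim
  obtain ⟨R2, hR2⟩ := eventually_atTop.1 hb_bound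
  rw [ae_restrict_iff' measurableSet_Ici] at hp1
  have hl1 : 0 < lam - 1 := by linarith
  set τ := (l - s + 1) / (1 - lam) with hτ
  have hτe : τ * (lam - 1) = s - 1 - l := by
    rw [hτ, div_mul_eq_mul_div, div_eq_iff (by linarith)]; ring
  obtain ⟨m, hm⟩ : ∃ m, m = 2 / (lam - 1) := ⟨_, rfl⟩
  have hm0 : 0 < m := by rw [hm]; positivity
  have hme : -m * lam = -m - 2 := by rw [hm]; field_simp; ring
  obtain ⟨T, hT⟩ : ∃ T : ℝ, T = 3 ^ |s| := ⟨_, rfl⟩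
  obtain ⟨L, hL⟩ : ∃ L : ℝ, L = 3 ^ |l| := ⟨_, rfl⟩
  have hT0 : 0 < T := by rw [hT]; positivity
  have hL0 : 0 < L := by rw [hL]; positivity
  obtain ⟨E, hE⟩ : ∃ E : ℝ, E = 4 * m ^ 2 + 6 * m + 2 * m * (B * T) + 1 := ⟨_, rfl⟩
  have hE0 : 0 < E := by rw [hE]; positivity
  obtain ⟨K, hK⟩ : ∃ K : ℝ, K = (E * L / c1) ^ (1 / (lam - 1)) := ⟨_, rfl⟩
  have hK0 : 0 < K := by rw [hK]; positivity
  have hKe : K ^ (lam - 1) = E * L / c1 := by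
    rw [hK, ← Real.rpow_mul (by positivity), one_div_mul_cancel hl1.ne', Real.rpow_one]
  refine ⟨K * (1 / 2) ^ τ, by positivity, ?_⟩
  intro w hw
  obtain ⟨hw1, hw2, hint, -, -, hsign, heq⟩ := hw
  rw [ae_restrict_iff' measurableSet_Ici] at heq
  filter_upwards [eventually_ge_atTop (2 * max (max a 1) (max R1 R2))] with ρ hρ
  obtain ⟨R, hR⟩ : ∃ R, R = ρ / 2 := ⟨_, rfl⟩
  have hρR : ρ = 2 * R := by rw [hR]; ring
  have hmaxR : max (max a 1) (max R1 R2) ≤ R := by rw [hR]; linarith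
  simp only [max_le_iff] at hmaxR
  obtain ⟨⟨hRa, hR1⟩, hRR1, hRR2⟩ := hmaxR
  have hR0 : 0 < R := by linarith
  obtain ⟨A, hA⟩ : ∃ A, A = K * R ^ τ := ⟨_, rfl⟩
  have hA0 : 0 < A := by rw [hA]; positivity
  have hgoal : K * (1 / 2) ^ τ * ρ ^ τ = A := by
    rw [hA, mul_assoc, ← Real.mul_rpow (by norm_num) (by linarith), hR]
    congr 2; ring
  rw [hgoal]
  by_contra! hcon
  have hAlam : c1 * (L⁻¹ * R ^ l) * A ^ lam = E * (A * R ^ (s - 1)) := by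
    have h1 : A ^ lam = A * A ^ (lam - 1) := by
      rw [Real.rpow_sub hA0, Real.rpow_one]; field_simp
    have h2 : A ^ (lam - 1) = E * L / c1 * (R ^ (s - 1) / R ^ l) := by
      rw [hA, Real.mul_rpow hK0.le (by positivity), hKe, ← Real.rpow_mul hR0.le, hτe,
        Real.rpow_sub hR0 (s - 1) l]
    have : 0 < R ^ l := by positivity
    rw [h1, h2]; field_simp
  have h2R : (2 * R) ∈ Ioo R (3 * R) := ⟨by linarith, by linarith⟩
  have hq2 : qq R (2 * R) = 1 := by
    unfold qq; rw [mul_div_assoc, div_self hR0.ne']; norm_num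
  have hx : ∀ r ∈ Ioo R (3 * R), 1 ≤ r / R ∧ r / R ≤ 3 := by
    intro r hr
    constructor
    · rw [le_div_iff₀ hR0]; linarith [hr.1]
    · rw [div_le_iff₀ hR0]; linarith [hr.2]
  have hrp : ∀ r ∈ Ioo R (3 * R), ∀ t : ℝ, r ^ t = (r / R) ^ t * R ^ t := by
    intro r hr t
    rw [← Real.mul_rpow (by linarith [hx r hr]) hR0.le, div_mul_cancel₀ _ hR0.ne']
  have hanti : ∀ r ∈ Icc R (3 * R), w r ≤ w R := by
    have : AntitoneOn w (Ici a) := by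
      apply antitoneOn_of_deriv_nonpos (convex_Ici a) hw1.continuous.continuousOn
        hw1.differentiableOn
      intro x hx
      rw [interior_Ici] at hx
      exact (hsign x (le_of_lt hx)).2
    intro r hr
    exact this hRa (hRa.trans hr.1) hr.1
  obtain ⟨t, ht0, ht1, htw⟩ : ∃ t : ℝ, 0 < t ∧ t ≤ 1 ∧ ∀ y, 0 < y → y ≤ t → w R ≤ A * y ^ (-m) := by
    have h1 : Tendsto (fun y : ℝ => A * y ^ (-m)) (nhdsWithin 0 (Ioi 0)) atTop :=
      (tendsto_rpow_neg_nhdsGT_zero (by linarith)).const_mul_atTop hA0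
    have h2 := h1.eventually_ge_atTop (w R)
    obtain ⟨u, hu, hu2⟩ := mem_nhdsGT_iff_exists_Ioc_subset.1 h2
    exact ⟨min u 1, lt_min hu one_pos, min_le_right _ _, fun y hy hy2 =>
      hu2 ⟨hy, hy2.trans (min_le_left _ _)⟩⟩
  have hqc : Continuous (qq R) := by unfold qq; fun_prop
  have hScomp : IsCompact (Icc R (3 * R) ∩ {r | t ≤ qq R r}) :=
    isCompact_Icc.inter_right (isClosed_le continuous_const hqc)
  have hSsub : ∀ r ∈ Icc R (3 * R) ∩ {r | t ≤ qq R r}, r ∈ Ioo R (3 * R) := by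
    rintro r ⟨hr, hr2⟩
    have hr2 : 0 < qq R r := lt_of_lt_of_le ht0 hr2
    refine ⟨lt_of_le_of_ne hr.1 ?_, lt_of_le_of_ne hr.2 ?_⟩
    · rintro rfl
      simp [qq, hR0.ne'] at hr2
    · rintro rfl
      simp [qq, hR0.ne'] at hr2
  have hd1 := fun r hr => barrier_deriv1 A m R r hR0 hr
  have hd2 := fun r hr => barrier_deriv2 A m R r hR0 hr
  have h2S : 2 * R ∈ Icc R (3 * R) ∩ {r | t ≤ qq R r} :=
    ⟨Ioo_subset_Icc_self h2R, by simp only [mem_ofPred_eq, hq2, ht1]⟩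
  obtain ⟨x0, hx0S, hx0max⟩ := hScomp.exists_isMaxOn (f := fun r => w r - A * qq R r ^ (-m))
    ⟨2 * R, h2S⟩ (fun r hr => (hw1.continuous.continuousAt.sub
      (hd1 r (hSsub r hr)).continuousAt).continuousWithinAt)
  have hx0 := hSsub x0 hx0S
  have hpos : A * qq R x0 ^ (-m) < w x0 := by
    have := hx0max h2S
    simp only [mem_ofPred_eq, hq2, Real.one_rpow] at this
    rw [hρR] at hcon
    linarith
  have hlm : IsLocalMax (fun r => w r - A * qq R r ^ (-m)) x0 := by
    filter_upwards [Ioo_mem_nhds hx0.1 hx0.2] with r hr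
    by_cases hrt : t ≤ qq R r
    · exact hx0max ⟨Ioo_subset_Icc_self hr, hrt⟩
    · have h1 := htw _ (qq_pos hR0 hr) (le_of_not_ge hrt)
      have h2 := hanti r (Ioo_subset_Icc_self hr)
      linarith
  have hRs : R ^ (s - 1) = R ^ s / R := by rw [Real.rpow_sub hR0, Real.rpow_one]
  have hRm2 : 1 / R ^ 2 ≤ R ^ (s - 1) := by
    have : 1 / R ^ 2 = R ^ (-2 : ℝ) := by
      rw [Real.rpow_neg hR0.le, one_div]; norm_num
    rw [this]
    exact Real.rpow_le_rpow_of_exponent_le hR1 (by linarith)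
  refine maxprin R (3 * R) x0 (A * R ^ (s - 1)) (B * (T * R ^ s)) lam hx0 (by positivity) hlam
    (by positivity) b p w _ _ _ hw1 hw2 ?_ hd1 hd2 ?_ ?_ hpos ?_ ?_ ?_ ?_ hlm
  · exact (hint R hRa).symm.trans (hint (3 * R) (by linarith))
  · have hc : ∀ e : ℝ, ContinuousOn (fun r => qq R r ^ e) (Ioo R (3 * R)) := fun e =>
      hqc.continuousOn.rpow_const (fun r hr => Or.inl (qq_pos hR0 hr).ne')
    have hc1 := hc (-m - 1)
    have hc2 := hc (-m - 2)
    fun_prop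
  · intro r hr
    have := Real.rpow_pos_of_pos (qq_pos hR0 hr) (-m)
    positivity
  · intro r hr
    refine (hR2 r (by linarith [hr.1])).trans ?_
    rw [hrp r hr s, hT]
    gcongr
    exact rpow_up (hx r hr).1 (hx r hr).2
  · intro r hr
    exact hp_nonneg r (by linarith [hr.1])
  · filter_upwards [heq] with r h1 hr hwr
    exact h1 (by simp only [mem_Ici]; linarith [hr.1]) hwr
  · filter_upwards [hp1] with r h1 hr
    have h1 := (h1 (by simp only [mem_Ici]; linarith [hr.1])).1
    have hq := qq_pos hR0 hr
    have hbb := barrier_bound A m R r (B * (T * R ^ s)) hA0 hm0 hR0 (by positivity) hr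
    have hQ1 : 1 ≤ qq R r ^ (-m - 2) :=
      Real.one_le_rpow_of_pos_of_le_one_of_nonpos hq qq_le (by linarith)
    have hpow : (A * qq R r ^ (-m)) ^ lam = A ^ lam * qq R r ^ (-m - 2) := by
      rw [Real.mul_rpow hA0.le (by positivity), ← Real.rpow_mul hq.le, hme]
    rw [hpow]
    have hlow : c1 * (L⁻¹ * R ^ l) ≤ p r := by
      refine le_trans ?_ h1
      rw [hrp r hr l, hL]
      gcongr
      exact rpow_down (hx r hr).1 (hx r hr).2
    set Q := qq R r ^ (-m - 2)
    have hX : (4 * m ^ 2 + 6 * m) / R ^ 2 ≤ (4 * m ^ 2 + 6 * m) * R ^ (s - 1) := by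
      rw [div_eq_mul_one_div]; gcongr
    have hAR : 0 < A * R ^ (s - 1) := by positivity
    calc _ ≤ A * Q * ((4 * m ^ 2 + 6 * m) / R ^ 2 + 2 * m * (B * (T * R ^ s)) / R)
          + A * R ^ (s - 1) * Q := add_le_add hbb (le_mul_of_one_le_right hAR.le hQ1)
      _ ≤ A * Q * ((4 * m ^ 2 + 6 * m) * R ^ (s - 1) + 2 * m * (B * (T * R ^ s)) / R)
          + A * R ^ (s - 1) * Q := by gcongr
      _ = E * (A * R ^ (s - 1)) * Q := by rw [hE, hRs]; field_simp
      _ = c1 * (L⁻¹ * R ^ l) * A ^ lam * Q := by rw [hAlam]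
      _ ≤ p r * A ^ lam * Q := by gcongr
      _ = _ := by ring
end

section
/- Suppose λ < 1, s > −1 and l < s − 1. Then there exists a constant C > 0, independent of the solution, such that every regular Kneser solution w of the second-order problem satisfies w(r) ≥ C r^{(l−s+1)/(1−λ)} for all sufficiently large r. -/
open MeasureTheory Filter Set

lemma cmp_aux (D D1 D2 : ℝ → ℝ) (r0 R K : ℝ) (hr : r0 ≤ R)
    (h1 : ∀ x, HasDerivAt D (D1 x) x) (h2 : ∀ x, HasDerivAt D1 (D2 x) x)
    (hi : IntervalIntegrable D2 volume r0 R)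
    (hae : ∀ᵐ x ∂(volume.restrict (Icc r0 R)), 0 < D x → K * D1 x ≤ D2 x)
    (hDR : 0 < D R) (hD1R : D1 R ≤ 0) : 0 < D r0 := by
  by_contra hneg
  have hDc : Continuous D := continuous_iff_continuousAt.2 fun x => (h1 x).continuousAt
  have hD1c : Continuous D1 := continuous_iff_continuousAt.2 fun x => (h2 x).continuousAt
  have hcpt : IsCompact (Icc r0 R ∩ D ⁻¹' Iic 0) :=
    isCompact_Icc.inter_right (isClosed_Iic.preimage hDc)
  obtain ⟨x1, ⟨hx1, hx1D⟩, hmax⟩ := hcpt.exists_isGreatest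
    ⟨r0, ⟨le_rfl, hr⟩, not_lt.1 hneg⟩
  have hpos : ∀ x, x1 < x → x ≤ R → 0 < D x := by
    intro x hx hxR
    by_contra hc
    exact absurd (hmax ⟨⟨hx1.1.trans hx.le, hxR⟩, not_lt.1 hc⟩) (not_le.2 hx)
  have hD1 : ∀ x ∈ Icc x1 R, D1 x ≤ 0 := by
    intro x hx
    have hd : ∀ y, HasDerivAt (fun y => D1 y * Real.exp (-K * y))
        ((D2 y - K * D1 y) * Real.exp (-K * y)) y := by
      intro y
      have he : HasDerivAt (fun y : ℝ => Real.exp (-K * y)) (Real.exp (-K * y) * (-K * 1)) y :=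
        ((hasDerivAt_id y).const_mul (-K)).exp
      refine ((h2 y).mul he).congr_deriv ?_
      ring
    have hsub : IntervalIntegrable D2 volume x R := by
      apply hi.mono_set
      rw [uIcc_of_le hx.2, uIcc_of_le hr]
      exact Icc_subset_Icc_left (hx1.1.trans hx.1)
    have hint : IntervalIntegrable (fun y => (D2 y - K * D1 y) * Real.exp (-K * y)) volume x R := by
      apply IntervalIntegrable.mul_continuousOn
      · exact hsub.sub ((continuous_const.mul hD1c).intervalIntegrable _ _)
      · fun_prop
    have hftc := intervalIntegral.integral_eq_sub_of_hasDerivAt (fun y _ => hd y) hint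
    have hnn : 0 ≤ ∫ y in x..R, (D2 y - K * D1 y) * Real.exp (-K * y) := by
      rw [intervalIntegral.integral_of_le hx.2]
      apply integral_nonneg_of_ae
      have hae' : ∀ᵐ y ∂(volume.restrict (Ioc x R)), 0 < D y → K * D1 y ≤ D2 y :=
        ae_restrict_of_ae_restrict_of_subset
          (show Ioc x R ⊆ Icc r0 R from
            fun y hy => ⟨hx1.1.trans (hx.1.trans hy.1.le), hy.2⟩) hae
      filter_upwards [hae', ae_restrict_mem measurableSet_Ioc] with y hy hy2
      have := hy (hpos y (lt_of_le_of_lt hx.1 hy2.1) hy2.2)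
      exact mul_nonneg (by linarith) (Real.exp_pos _).le
    rw [hftc] at hnn
    have : D1 R * Real.exp (-K * R) ≤ 0 := mul_nonpos_of_nonpos_of_nonneg hD1R (Real.exp_pos _).le
    by_contra hc
    have := mul_pos (not_le.1 hc) (Real.exp_pos (-K * x))
    linarith
  have hanti : AntitoneOn D (Icc x1 R) := by
    apply antitoneOn_of_deriv_nonpos (convex_Icc _ _) hDc.continuousOn
    · exact fun x _ => (h1 x).differentiableAt.differentiableWithinAt
    · intro x hx
      rw [(h1 x).deriv]
      exact hD1 x (interior_subset hx)
  have := hanti (left_mem_Icc.2 hx1.2) (right_mem_Icc.2 hx1.2) hx1.2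
  have h0 : D x1 ≤ 0 := hx1D
  linarith

lemma core_aux (w : ℝ → ℝ) (K P μ r0 : ℝ) (hμ0 : 0 ≤ μ) (hμ1 : μ < 1) (hr0 : 0 < r0)
    (hK : 0 ≤ K) (hP : 0 < P) (hw : Differentiable ℝ w) (hw' : Differentiable ℝ (deriv w))
    (hi : IntervalIntegrable (deriv (deriv w)) volume r0 (2 * r0))
    (hpos : ∀ r ∈ Icc r0 (2 * r0), 0 < w r) (hend : deriv w (2 * r0) ≤ 0)
    (hae : ∀ᵐ r ∂(volume.restrict (Icc r0 (2 * r0))),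
      P * w r ^ μ + K * deriv w r ≤ deriv (deriv w) r) :
    P / ((2 / (1 - μ)) * (2 / (1 - μ) + K * r0)) * r0 ^ 2 ≤ w r0 ^ (1 - μ) := by
  have h1μ : 0 < 1 - μ := by linarith
  obtain ⟨m, hm⟩ : ∃ m, m = 2 / (1 - μ) := ⟨_, rfl⟩
  rw [← hm]
  have hmm : m * (1 - μ) = 2 := by rw [hm]; field_simp
  have hm2 : 2 ≤ m := by nlinarith
  have hexp : m - 2 = m * μ := by linarith
  have hKr : 0 ≤ K * r0 := by positivity
  obtain ⟨Q, hQ⟩ : ∃ Q, Q = P / (m * (m + K * r0)) := ⟨_, rfl⟩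
  rw [← hQ]
  have hden : 0 < m * (m + K * r0) := by positivity
  have hQ0 : 0 < Q := by rw [hQ]; positivity
  have hPQ : Q * (m * (m + K * r0)) = P := by rw [hQ]; field_simp
  obtain ⟨A, hA⟩ : ∃ A, A = Q ^ (1 / (1 - μ)) := ⟨_, rfl⟩
  have hA0 : 0 < A := by rw [hA]; positivity
  have hAQ : A ^ (1 - μ) = Q := by
    rw [hA, ← Real.rpow_mul hQ0.le, one_div_mul_cancel h1μ.ne', Real.rpow_one]
  have hAA : A = A ^ μ * Q := by
    rw [← hAQ, ← Real.rpow_add hA0]; simp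
  by_contra hlt
  have hlt := not_le.1 hlt
  have hz0 : (A * r0 ^ m) ^ (1 - μ) = Q * r0 ^ 2 := by
    rw [Real.mul_rpow hA0.le (by positivity), hAQ, ← Real.rpow_mul hr0.le, hmm]
    norm_num
  rw [← hz0] at hlt
  have hw0 : w r0 < A * r0 ^ m :=
    (Real.rpow_lt_rpow_iff (hpos r0 ⟨le_rfl, by linarith⟩).le (by positivity) h1μ).1 hlt
  obtain ⟨R, hR⟩ : ∃ R, R = 2 * r0 := ⟨_, rfl⟩
  rw [← hR] at hi hend hae hpos
  have hlin : ∀ x : ℝ, HasDerivAt (fun x : ℝ => R - x) (-1) x := fun x => by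
    simpa using (hasDerivAt_id x).const_sub R
  have hz1 : ∀ x : ℝ, HasDerivAt (fun x => A * (R - x) ^ m) (-(A * m * (R - x) ^ (m - 1))) x := by
    intro x
    refine (((hlin x).rpow_const (p := m) (Or.inr (by linarith))).const_mul A).congr_deriv ?_
    ring
  have hz2 : ∀ x : ℝ, HasDerivAt (fun x => -(A * m * (R - x) ^ (m - 1)))
      (A * m * (m - 1) * (R - x) ^ (m - 2)) x := by
    intro x
    refine ((((hlin x).rpow_const (p := m - 1) (Or.inr (by linarith))).const_mul
      (A * m)).neg).congr_deriv ?_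
    rw [show m - 1 - 1 = m - 2 by ring]
    ring
  have hc : Continuous (fun x : ℝ => A * m * (m - 1) * (R - x) ^ (m - 2)) := by
    apply continuous_const.mul
    exact (continuous_const.sub continuous_id).rpow_const (fun _ => Or.inr (by linarith))
  have key := cmp_aux (fun x => w x - A * (R - x) ^ m)
    (fun x => deriv w x - -(A * m * (R - x) ^ (m - 1)))
    (fun x => deriv (deriv w) x - A * m * (m - 1) * (R - x) ^ (m - 2)) r0 R K (by linarith)
    (fun x => (hw x).hasDerivAt.sub (hz1 x)) (fun x => (hw' x).hasDerivAt.sub (hz2 x))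
    (hi.sub (hc.intervalIntegrable _ _)) ?_ ?_ ?_
  · have : R - r0 = r0 := by linarith
    simp only [this] at key
    linarith
  · filter_upwards [hae, ae_restrict_mem measurableSet_Icc] with x hx hxm hD
    have ht0 : 0 ≤ R - x := by linarith [hxm.2]
    have ht1 : R - x ≤ r0 := by linarith [hxm.1]
    obtain ⟨t, ht⟩ : ∃ t, t = R - x := ⟨_, rfl⟩
    rw [← ht] at ht0 ht1 hD ⊢
    have e1 : t ^ (m - 1) = t ^ (m * μ) * t := by
      rw [← hexp]
      rcases ht0.eq_or_lt with h | h
      · rw [← h, Real.zero_rpow (by linarith)]; simp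
      · rw [show m - 1 = (m - 2) + 1 by ring, Real.rpow_add h, Real.rpow_one]
    have hzw : A ^ μ * t ^ (m * μ) ≤ w x ^ μ := by
      rw [Real.rpow_mul ht0, ← Real.mul_rpow hA0.le (by positivity)]
      exact Real.rpow_le_rpow (by positivity) (by linarith) hμ0
    have hT : 0 ≤ t ^ (m * μ) := by positivity
    have hmain : A * m * (m - 1) * t ^ (m * μ) + K * (A * m * (t ^ (m * μ) * t))
        ≤ P * (A ^ μ * t ^ (m * μ)) := by
      have hb : m * ((m - 1) + K * t) ≤ m * (m + K * r0) := by
        apply mul_le_mul_of_nonneg_left _ (by linarith)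
        have := mul_le_mul_of_nonneg_left ht1 hK
        linarith
      calc A * m * (m - 1) * t ^ (m * μ) + K * (A * m * (t ^ (m * μ) * t))
          = (A * t ^ (m * μ)) * (m * ((m - 1) + K * t)) := by ring
        _ ≤ (A * t ^ (m * μ)) * (m * (m + K * r0)) :=
            mul_le_mul_of_nonneg_left hb (by positivity)
        _ = (A ^ μ * Q * t ^ (m * μ)) * (m * (m + K * r0)) := by rw [← hAA]
        _ = (Q * (m * (m + K * r0))) * (A ^ μ * t ^ (m * μ)) := by ring
        _ = _ := by rw [hPQ]
    have := mul_le_mul_of_nonneg_left hzw hP.le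
    rw [e1, hexp]
    linarith
  · have := hpos R ⟨by linarith, le_rfl⟩
    simp only [sub_self]
    rw [Real.zero_rpow (by linarith)]
    linarith
  · simp only [sub_self]
    rw [Real.zero_rpow (by linarith)]
    linarith

lemma rpow_up_aux (r0 x s : ℝ) (hr0 : 0 < r0) (h1 : r0 ≤ x) (h2 : x ≤ 2 * r0) :
    x ^ s ≤ 2 ^ |s| * r0 ^ s := by
  have hq : x = (x / r0) * r0 := by field_simp
  have hq1 : 1 ≤ x / r0 := by rw [le_div_iff₀ hr0]; linarith
  have hq2 : x / r0 ≤ 2 := by rw [div_le_iff₀ hr0]; linarith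
  rw [hq, Real.mul_rpow (by linarith) hr0.le]
  apply mul_le_mul_of_nonneg_right _ (by positivity)
  calc (x / r0) ^ s ≤ (x / r0) ^ |s| := Real.rpow_le_rpow_of_exponent_le hq1 (le_abs_self s)
    _ ≤ 2 ^ |s| := Real.rpow_le_rpow (by linarith) hq2 (abs_nonneg s)

lemma rpow_lo_aux (r0 x s : ℝ) (hr0 : 0 < r0) (h1 : r0 ≤ x) (h2 : x ≤ 2 * r0) :
    (2 ^ |s|)⁻¹ * r0 ^ s ≤ x ^ s := by
  have h := rpow_up_aux r0 x (-s) hr0 h1 h2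
  have hx : 0 < x := by linarith
  rw [abs_neg, Real.rpow_neg hx.le, Real.rpow_neg hr0.le] at h
  have := inv_anti₀ (by positivity) h
  simpa [mul_inv, mul_comm] using this

/-- Example 2.4 (lower estimate, case `s > -1`): if `λ < 1`, `s > -1`, `l < s - 1`,
`|b(r)| ≤ B r^s` for large `r` and `p(r) ∼ r^l` at infinity, then there is `C > 0`,
independent of the solution, such that every regular Kneser solution of
`w'' + b(r) w' = p(r) w^λ` satisfies `w(r) ≥ C r^{(l-s+1)/(1-λ)}` for all sufficiently
large `r`. -/
theorem second_order_lower_estimate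
    (a lam s l B : ℝ) (ha : 0 < a) (hlam : lam < 1) (hs : -1 < s) (hl : l < s - 1)
    (hB : 0 < B) (b p : ℝ → ℝ) (hb_meas : Measurable b) (hp_meas : Measurable p)
    (hb_loc : ∀ r, ∃ M, ∀ x ∈ Icc a r, |b x| ≤ M)
    (hp_loc : ∀ r, ∃ M, ∀ x ∈ Icc a r, |p x| ≤ M)
    (hp_nonneg : ∀ r, a ≤ r → 0 ≤ p r)
    (hb_bound : ∀ᶠ r in atTop, |b r| ≤ B * r ^ s)
    (hp_sim : ∃ c₁ > (0 : ℝ), ∃ c₂ > (0 : ℝ), ∃ R : ℝ,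
      ∀ᵐ r ∂(volume.restrict (Ici R)), c₁ * r ^ l ≤ p r ∧ p r ≤ c₂ * r ^ l) :
    ∃ C, 0 < C ∧ ∀ w : ℝ → ℝ, IsKneser2 a b p (fun t => t ^ lam) w →
      (∀ r, a ≤ r → 0 < w r) →
      ∀ᶠ r in atTop, C * r ^ ((l - s + 1) / (1 - lam)) ≤ w r := by
  obtain ⟨c1, hc1, c2, hc2, R, hp⟩ := hp_sim
  obtain ⟨R1, hR1⟩ := eventually_atTop.1 hb_bound
  obtain ⟨μ, hμ⟩ : ∃ μ, μ = max lam 0 := ⟨_, rfl⟩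
  have hμ0 : 0 ≤ μ := hμ ▸ le_max_right _ _
  have hμl : lam ≤ μ := hμ ▸ le_max_left _ _
  have hμ1 : μ < 1 := by rw [hμ]; exact max_lt hlam one_pos
  have h1μ : 0 < 1 - μ := by linarith
  have h1l : 0 < 1 - lam := by linarith
  obtain ⟨m, hm⟩ : ∃ m, m = 2 / (1 - μ) := ⟨_, rfl⟩
  have hm0 : 0 < m := by rw [hm]; positivity
  obtain ⟨k, hk⟩ : ∃ k, k = B * 2 ^ |s| := ⟨_, rfl⟩
  have hk0 : 0 < k := by rw [hk]; positivity
  obtain ⟨c, hc⟩ : ∃ c, c = c1 * (2 ^ |l|)⁻¹ := ⟨_, rfl⟩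
  have hc0 : 0 < c := by rw [hc]; positivity
  obtain ⟨c', hc'⟩ : ∃ c', c' = c / (m * (m + k)) := ⟨_, rfl⟩
  have hc'0 : 0 < c' := by rw [hc']; positivity
  refine ⟨c' ^ (1 / (1 - lam)), by positivity, ?_⟩
  rintro w ⟨hw, hw', hi, -, -, hsgn, heq⟩ hpos
  filter_upwards [eventually_ge_atTop a, eventually_ge_atTop 1, eventually_ge_atTop R,
    eventually_ge_atTop R1] with r0 h0a h01 h0R h0R1
  have hr0 : 0 < r0 := by linarith
  have hw0 := hpos r0 h0a
  have hanti : AntitoneOn w (Ici a) := by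
    apply antitoneOn_of_deriv_nonpos (convex_Ici _) hw.continuous.continuousOn
    · exact fun x _ => (hw x).differentiableWithinAt
    · exact fun x hx => (hsgn x (interior_subset hx)).2
  have key := core_aux w (k * r0 ^ s) (c * r0 ^ l * w r0 ^ (lam - μ)) μ r0 hμ0 hμ1 hr0
    (by positivity) (by positivity) hw hw' ?_ (fun r hr => hpos r (h0a.trans hr.1))
    (hsgn _ (by linarith)).2 ?_
  · rw [← hm] at key
    have hkr : k * r0 ^ s * r0 = k * r0 ^ (s + 1) := by
      rw [Real.rpow_add hr0, Real.rpow_one]; ring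
    rw [hkr] at key
    have hone : 1 ≤ r0 ^ (s + 1) := Real.one_le_rpow h01 (by linarith)
    have hle : m * (m + k * r0 ^ (s + 1)) ≤ m * (m + k) * r0 ^ (s + 1) := by
      have := mul_le_mul_of_nonneg_left hone (mul_pos hm0 hm0).le
      linarith
    have hkey2 : c * r0 ^ l * w r0 ^ (lam - μ) / (m * (m + k) * r0 ^ (s + 1)) * r0 ^ 2
        ≤ w r0 ^ (1 - μ) := by
      refine le_trans ?_ key
      gcongr
    have hsplit : w r0 ^ (1 - μ) = w r0 ^ (1 - lam) * w r0 ^ (lam - μ) := by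
      rw [← Real.rpow_add hw0]; congr 1; ring
    have hpw : r0 ^ (l - s + 1) = r0 ^ l / r0 ^ (s + 1) * r0 ^ 2 := by
      rw [← Real.rpow_natCast r0 2, ← Real.rpow_sub hr0, ← Real.rpow_add hr0]
      congr 1; push_cast; ring
    have hfin : c' * r0 ^ (l - s + 1) ≤ w r0 ^ (1 - lam) := by
      have hwp : 0 < w r0 ^ (lam - μ) := by positivity
      rw [hsplit] at hkey2
      refine le_of_mul_le_mul_right (le_trans (le_of_eq ?_) hkey2) hwp
      rw [hpw, hc']
      field_simp
    have h3 := Real.rpow_le_rpow (by positivity) hfin (by positivity : 0 ≤ 1 / (1 - lam))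
    rw [Real.mul_rpow hc'0.le (by positivity), ← Real.rpow_mul hr0.le, ← Real.rpow_mul hw0.le,
      mul_one_div_cancel h1l.ne', Real.rpow_one, mul_one_div] at h3
    exact h3
  · exact (hi r0 h0a).symm.trans (hi (2 * r0) (by linarith))
  · have heq' : ∀ᵐ r ∂(volume.restrict (Icc r0 (2 * r0))), 0 < w r →
        deriv (deriv w) r + b r * deriv w r = p r * w r ^ lam :=
      ae_restrict_of_ae_restrict_of_subset (fun y hy => h0a.trans hy.1) heq
    have hp' : ∀ᵐ r ∂(volume.restrict (Icc r0 (2 * r0))), c1 * r ^ l ≤ p r ∧ p r ≤ c2 * r ^ l :=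
      ae_restrict_of_ae_restrict_of_subset (fun y hy => h0R.trans hy.1) hp
    filter_upwards [heq', hp', ae_restrict_mem measurableSet_Icc] with x hx hpx hxm
    have hax : a ≤ x := h0a.trans hxm.1
    have hwx := hpos x hax
    have he := hx hwx
    have hbx : b x ≥ -(k * r0 ^ s) := by
      have h1 := hR1 x (h0R1.trans hxm.1)
      have h2 := mul_le_mul_of_nonneg_left (rpow_up_aux r0 x s hr0 hxm.1 hxm.2) hB.le
      have h3 := neg_abs_le (b x)
      rw [hk]
      linarith
    have hpl : c * r0 ^ l ≤ p x := by
      have h2 := mul_le_mul_of_nonneg_left (rpow_lo_aux r0 x l hr0 hxm.1 hxm.2) hc1.le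
      rw [hc]
      linarith [hpx.1]
    have hwm : w r0 ^ (lam - μ) ≤ w x ^ (lam - μ) :=
      Real.rpow_le_rpow_of_nonpos hwx (hanti h0a hax hxm.1) (by linarith)
    have hws : w x ^ lam = w x ^ (lam - μ) * w x ^ μ := by
      rw [← Real.rpow_add hwx]; congr 1; ring
    have h5 : c * r0 ^ l * w r0 ^ (lam - μ) * w x ^ μ ≤ p x * w x ^ lam := by
      rw [hws, mul_assoc]
      have hpx0 : 0 ≤ p x := hp_nonneg x hax
      gcongr
    have h6 : k * r0 ^ s * deriv w x ≤ - b x * deriv w x :=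
      by nlinarith [mul_nonneg (by linarith : 0 ≤ b x + k * r0 ^ s) (neg_nonneg.2 (hsgn x hax).2)]
    linarith
end

section
/- Suppose λ > 1, s > −1 and ν > −1, where now p satisfies, for some constants c_1, c_2 > 0, c_1 r^{s−1} (log r)^ν ≤ p(r) ≤ c_2 r^{s−1} (log r)^ν for almost all sufficiently large r. Then there exists a constant C > 0, independent of the solution, such that every Kneser solution w of the second-order problem satisfies w(r) ≤ C (log r)^{(ν+1)/(1−λ)} for all sufficiently large r. -/
open MeasureTheory Filter Set

lemma barrier_aux (g g' : ℝ → ℝ) (R : ℝ) (hd : ∀ t, R ≤ t → HasDerivAt g (g' t) t)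
    (hi : ∀ x y, R ≤ x → x ≤ y → IntervalIntegrable g' volume x y)
    (hn : ∀ᵐ t ∂(volume : Measure ℝ), R ≤ t → g t < 0 → g' t ≤ 0)
    (r0 : ℝ) (hr0 : R ≤ r0) (hg : g r0 < 0) : ∀ r, r0 ≤ r → g r ≤ g r0 := by
  intro r1 hr1
  by_contra hcon
  push Not at hcon
  set c := min (g r1) (g r0 / 2) with hc
  have hc1 : g r0 < c := lt_min hcon (by linarith)
  have hc0 : c < 0 := lt_of_le_of_lt (min_le_right _ _) (by linarith)
  have hcr : c ≤ g r1 := min_le_left _ _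
  have hcont : ContinuousOn g (Icc r0 r1) := fun t ht =>
    (hd t (hr0.trans ht.1)).continuousAt.continuousWithinAt
  set S := Icc r0 r1 ∩ g ⁻¹' (Ici c) with hS
  have hSc : IsClosed S := hcont.preimage_isClosed_of_isClosed isClosed_Icc isClosed_Ici
  have hSne : S.Nonempty := ⟨r1, ⟨hr1, le_rfl⟩, hcr⟩
  have hSb : BddBelow S := ⟨r0, fun t ht => ht.1.1⟩
  have hmem : sInf S ∈ S := hSc.csInf_mem hSne hSb
  set t1 := sInf S with ht1
  have h01 : r0 ≤ t1 := hmem.1.1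
  have hlt : ∀ t, r0 ≤ t → t < t1 → g t < c := by
    intro t h1 h2
    by_contra h3
    push Not at h3
    exact absurd (csInf_le hSb (⟨⟨h1, h2.le.trans hmem.1.2⟩, h3⟩ : t ∈ S)) (not_le.mpr h2)
  have hint : ∫ t in r0..t1, g' t = g t1 - g r0 := by
    apply intervalIntegral.integral_eq_sub_of_hasDerivAt
    · intro t ht
      rw [uIcc_of_le h01] at ht
      exact hd t (hr0.trans ht.1)
    · exact hi _ _ hr0 h01
  have hle : ∫ t in r0..t1, g' t ≤ 0 := by
    rw [intervalIntegral.integral_of_le h01, integral_Ioc_eq_integral_Ioo]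
    apply integral_nonpos_of_ae
    rw [Filter.EventuallyLE, ae_restrict_iff' measurableSet_Ioo]
    filter_upwards [hn] with t ht hts
    exact ht (hr0.trans hts.1.le) ((hlt t hts.1.le hts.2).trans hc0)
  have : c ≤ g t1 := hmem.2
  linarith

lemma ptwise_aux (B lam rs h h' W W1 M1 v b p ri w2 : ℝ) (hlam : 1 < lam) (hB : 0 < B)
    (hrs : 0 < rs) (hh : 0 < h) (hW : 0 < W) (hW1 : 0 ≤ W1) (hWM : W1 ≤ M1)
    (hb : |b| ≤ B * rs) (hp : 2 * B * rs * h ≤ p) (hv : 0 ≤ v) (hvh : v < h * W)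
    (hh' : -(2 * h * ri) ≤ h') (heq : w2 + b * (-v) = p * W)
    (hbig : 2 * ri + lam * h * M1 ≤ B * rs) :
    -w2 - (h' * W + h * ((-v) * lam * W1)) ≤ 0 := by
  have e1 : -b * v ≤ B * rs * v := mul_le_mul_of_nonneg_right ((neg_le_abs b).trans hb) hv
  have e2 : B * rs * v ≤ B * rs * (h * W) := by gcongr
  have e3 : 2 * B * rs * h * W ≤ p * W := by gcongr
  have e4 : -(2 * h * ri) * W ≤ h' * W := by gcongr
  have e5 : h * (v * lam * W1) ≤ h * ((h * W) * lam * M1) := by gcongr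
  have e6 : (2 * ri + lam * h * M1) * (h * W) ≤ B * rs * (h * W) := by gcongr
  nlinarith

lemma final_aux (w : ℝ → ℝ) (lam ν k R : ℝ) (hlam : 1 < lam) (hν : -1 < ν) (hk : 0 < k)
    (hR : 1 < R) (hw : Differentiable ℝ w) (hpos : ∀ r, R ≤ r → 0 < w r)
    (hin : ∀ r, R ≤ r → k * r⁻¹ * Real.log r ^ ν * w r ^ lam ≤ -deriv w r) :
    ∀ᶠ r in atTop, w r ≤ ((lam - 1) * k / (2 * (ν + 1))) ^ (1 / (1 - lam)) *
      Real.log r ^ ((ν + 1) / (1 - lam)) := by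
  set c := (lam - 1) * k / (2 * (ν + 1)) with hc
  have hν1 : 0 < ν + 1 := by linarith
  have hcpos : 0 < c := by
    have : 0 < lam - 1 := by linarith
    positivity
  have hlog : ∀ r, R ≤ r → 0 < Real.log r := fun r hr => Real.log_pos (by linarith)
  have hder : ∀ r, R ≤ r → HasDerivAt (fun r => w r ^ (1 - lam) - 2 * c * Real.log r ^ (ν + 1))
      (deriv w r * (1 - lam) * w r ^ (1 - lam - 1) -
        2 * c * (r⁻¹ * (ν + 1) * Real.log r ^ (ν + 1 - 1))) r := by
    intro r hr
    exact ((hw r).hasDerivAt.rpow_const (Or.inl (hpos r hr).ne')).sub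
      (((Real.hasDerivAt_log (by linarith)).rpow_const (Or.inl (hlog r hr).ne')).const_mul _)
  have hmono : MonotoneOn (fun r => w r ^ (1 - lam) - 2 * c * Real.log r ^ (ν + 1)) (Ici R) := by
    apply monotoneOn_of_deriv_nonneg (convex_Ici R)
    · exact fun r hr => (hder r hr).continuousAt.continuousWithinAt
    · intro r hr
      rw [interior_Ici] at hr
      exact (hder r (le_of_lt hr)).differentiableAt.differentiableWithinAt
    · intro r hr
      rw [interior_Ici] at hr
      have hr' : R ≤ r := le_of_lt hr
      rw [(hder r hr').deriv]
      have hwp := hpos r hr'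
      have e1 : (1 - lam - 1) = -lam := by ring
      have e2 : ν + 1 - 1 = ν := by ring
      rw [e1, e2]
      have hm := mul_le_mul_of_nonneg_right (hin r hr') (Real.rpow_pos_of_pos hwp (-lam)).le
      have e3 : w r ^ lam * w r ^ (-lam) = 1 := by
        rw [← Real.rpow_add hwp]; simp
      have e4 : 2 * c * (ν + 1) = (lam - 1) * k := by
        rw [hc]; field_simp
      have e5 : k * r⁻¹ * Real.log r ^ ν ≤ -deriv w r * w r ^ (-lam) := by
        calc _ = k * r⁻¹ * Real.log r ^ ν * (w r ^ lam * w r ^ (-lam)) := by rw [e3, mul_one]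
          _ ≤ _ := by linarith
      have e6 := mul_le_mul_of_nonneg_left e5 (by linarith : 0 ≤ lam - 1)
      have e7 : 2 * c * (r⁻¹ * (ν + 1) * Real.log r ^ ν) =
        (lam - 1) * (k * r⁻¹ * Real.log r ^ ν) := by
        calc _ = (2 * c * (ν + 1)) * (r⁻¹ * Real.log r ^ ν) := by ring
          _ = _ := by rw [e4]; ring
      rw [e7]
      linarith
  have ht : Tendsto (fun r => Real.log r ^ (ν + 1)) atTop atTop :=
    (tendsto_rpow_atTop hν1).comp Real.tendsto_log_atTop
  filter_upwards [ht.eventually_ge_atTop (2 * Real.log R ^ (ν + 1)), eventually_ge_atTop R]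
    with r h1 h2
  have hm := hmono (mem_Ici.mpr le_rfl) (mem_Ici.mpr h2) h2
  have hwp := hpos r h2
  have hR0 := (Real.rpow_pos_of_pos (hpos R le_rfl) (1 - lam)).le
  have h3 : c * Real.log r ^ (ν + 1) ≤ w r ^ (1 - lam) := by
    simp only at hm
    nlinarith
  have hl := hlog r h2
  have h4 : (w r ^ (1 - lam)) ^ (1 / (1 - lam)) ≤
      (c * Real.log r ^ (ν + 1)) ^ (1 / (1 - lam)) :=
    Real.rpow_le_rpow_of_nonpos (by positivity) h3
      (div_nonpos_of_nonneg_of_nonpos (by norm_num) (by linarith))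
  rw [← Real.rpow_mul hwp.le, mul_one_div_cancel (by linarith), Real.rpow_one,
    Real.mul_rpow hcpos.le (by positivity), ← Real.rpow_mul hl.le] at h4
  convert h4 using 3
  ring

lemma tendsto_aux (s ν : ℝ) (hs : -1 < s) :
    Tendsto (fun r : ℝ => Real.log r ^ ν * r ^ (-(s + 1))) atTop (nhds 0) := by
  have h := (isLittleO_log_rpow_rpow_atTop ν (by linarith : 0 < s + 1)).tendsto_div_nhds_zero
  refine h.congr' ?_
  filter_upwards [eventually_gt_atTop 0] with r hr
  rw [Real.rpow_neg hr.le, div_eq_mul_inv]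

theorem second_order_log_upper_estimate
    (a lam s ν B : ℝ) (ha : 1 < a) (hlam : 1 < lam) (hs : -1 < s) (hν : -1 < ν)
    (hB : 0 < B) (b p : ℝ → ℝ) (hb_meas : Measurable b) (hp_meas : Measurable p)
    (hb_loc : ∀ r, ∃ M, ∀ x ∈ Icc a r, |b x| ≤ M)
    (hp_loc : ∀ r, ∃ M, ∀ x ∈ Icc a r, |p x| ≤ M)
    (hp_nonneg : ∀ r, a ≤ r → 0 ≤ p r)
    (hb_bound : ∀ᶠ r in atTop, |b r| ≤ B * r ^ s)
    (hp_sim : ∃ c₁ > (0 : ℝ), ∃ c₂ > (0 : ℝ), ∃ R : ℝ,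
      ∀ᵐ r ∂(volume.restrict (Ici R)),
        c₁ * r ^ (s - 1) * Real.log r ^ ν ≤ p r ∧ p r ≤ c₂ * r ^ (s - 1) * Real.log r ^ ν) :
    ∃ C, 0 < C ∧ ∀ w : ℝ → ℝ, IsKneser2 a b p (fun t => t ^ lam) w →
      ∀ᶠ r in atTop, w r ≤ C * Real.log r ^ ((ν + 1) / (1 - lam)) := by
  obtain ⟨c₁, hc₁, c₂, hc₂, Rp, hp⟩ := hp_sim
  set k := c₁ / (2 * B) with hk
  have hkpos : 0 < k := by positivity
  have hν1 : 0 < ν + 1 := by linarith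
  have hl1 : 0 < lam - 1 := by linarith
  have hCpos : 0 < ((lam - 1) * k / (2 * (ν + 1))) ^ (1 / (1 - lam)) :=
    Real.rpow_pos_of_pos (by positivity) _
  refine ⟨_, hCpos, ?_⟩
  rintro w ⟨hw, hw', hint, -, -, hsgn, heq⟩
  have hanti : AntitoneOn w (Ici a) := by
    apply antitoneOn_of_deriv_nonpos (convex_Ici a) hw.continuous.continuousOn
      hw.differentiableOn
    intro r hr
    rw [interior_Ici] at hr
    exact (hsgn r (le_of_lt hr)).2
  by_cases hz : ∃ r, a ≤ r ∧ w r = 0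
  · obtain ⟨r, har, hr⟩ := hz
    filter_upwards [eventually_ge_atTop r] with x hx
    have h1 := hanti (mem_Ici.mpr har) (mem_Ici.mpr (har.trans hx)) hx
    have h2 : 0 ≤ Real.log x := Real.log_nonneg (by linarith)
    rw [hr] at h1
    exact h1.trans (by positivity)
  have hpos : ∀ r, a ≤ r → 0 < w r := by
    intro r hr
    exact lt_of_le_of_ne (hsgn r hr).1 (fun h => hz ⟨r, hr, h.symm⟩)
  set M1 := w a ^ (lam - 1) with hM1
  set h : ℝ → ℝ := fun r => k * r⁻¹ * Real.log r ^ ν with hh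
  set h' : ℝ → ℝ := fun r => k * (-(r ^ 2)⁻¹) * Real.log r ^ ν +
    k * r⁻¹ * (r⁻¹ * ν * Real.log r ^ (ν - 1)) with hh'
  have hhder : ∀ r, 1 < r → HasDerivAt h (h' r) r := by
    intro r hr
    exact ((hasDerivAt_inv (by linarith)).const_mul k).mul
      ((Real.hasDerivAt_log (by linarith)).rpow_const (Or.inl (Real.log_pos hr).ne'))
  -- threshold
  have hbig : ∀ᶠ r in atTop, 2 * r⁻¹ + lam * h r * M1 ≤ B * r ^ s := by
    have t1 := (tendsto_aux s 0 hs).const_mul 2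
    have t2 := (tendsto_aux s ν hs).const_mul (lam * k * M1)
    have t3 := t1.add t2
    simp only [mul_zero, add_zero] at t3
    filter_upwards [t3.eventually_le_const hB, eventually_gt_atTop 0] with r h1 h2
    have h3 : r ^ (-(s + 1)) * r ^ s = r⁻¹ := by
      rw [← Real.rpow_add h2, ← Real.rpow_neg_one]; congr 1; ring
    have h4 := mul_le_mul_of_nonneg_right h1 (Real.rpow_nonneg h2.le s)
    rw [Real.rpow_zero, one_mul] at h4
    calc _ = (2 * r ^ (-(s + 1)) + lam * k * M1 * (Real.log r ^ ν * r ^ (-(s + 1)))) * r ^ s := by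
            simp only [hh]; rw [← h3]; ring
      _ ≤ _ := h4
  obtain ⟨R, hR⟩ := eventually_atTop.mp (hbig.and (hb_bound.and
    ((eventually_ge_atTop a).and ((eventually_ge_atTop Rp).and
      (Real.tendsto_log_atTop.eventually_ge_atTop |ν|)))))
  have hRa : a ≤ R := (hR R le_rfl).2.2.1
  have hRp : Rp ≤ R := (hR R le_rfl).2.2.2.1
  have hhpos : ∀ r, R ≤ r → 0 < h r := by
    intro r hr
    have h1 : 0 < Real.log r := Real.log_pos (by linarith)
    have h2 : 0 < r := by linarith
    simp only [hh]
    positivity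
  set g : ℝ → ℝ := fun r => -deriv w r - h r * w r ^ lam with hg
  set g' : ℝ → ℝ := fun r => -deriv (deriv w) r -
    (h' r * w r ^ lam + h r * (deriv w r * lam * w r ^ (lam - 1))) with hg'
  have hgder : ∀ r, R ≤ r → HasDerivAt g (g' r) r := by
    intro r hr
    exact (hw' r).hasDerivAt.neg.sub ((hhder r (by linarith)).mul
      ((hw r).hasDerivAt.rpow_const (Or.inr hlam.le)))
  have hgint : ∀ x y, R ≤ x → x ≤ y → IntervalIntegrable g' volume x y := by
    intro x y hx hxy
    have i1 : IntervalIntegrable (deriv (deriv w)) volume x y :=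
      (hint x (by linarith)).symm.trans (hint y (by linarith))
    refine i1.neg.sub (ContinuousOn.intervalIntegrable ?_)
    rw [uIcc_of_le hxy]
    intro t ht
    apply ContinuousAt.continuousWithinAt
    have ht1 : 1 < t := by linarith [ht.1]
    have ht0 : t ≠ 0 := by linarith
    have hl : Real.log t ≠ 0 := (Real.log_pos ht1).ne'
    have hwt : w t ≠ 0 := (hpos t (by linarith [ht.1])).ne'
    have c1 := (hw t).continuousAt
    have c2 := (hw' t).continuousAt
    have c3 := Real.continuousAt_log ht0
    have c4 : ContinuousAt (fun r : ℝ => r⁻¹) t := continuousAt_inv₀ ht0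
    have c5 : ContinuousAt (fun r : ℝ => (r ^ 2)⁻¹) t :=
      (continuousAt_id.pow 2).inv₀ (pow_ne_zero 2 ht0)
    have c6 : ContinuousAt h' t :=
      ((continuousAt_const.mul c5.neg).mul (c3.rpow_const (Or.inl hl))).add
      ((continuousAt_const.mul c4).mul
        ((c4.mul continuousAt_const).mul (c3.rpow_const (Or.inl hl))))
    exact (c6.mul (c1.rpow_const (Or.inl hwt))).add
      ((hhder t ht1).continuousAt.mul
        ((c2.mul continuousAt_const).mul (c1.rpow_const (Or.inl hwt))))
  have hgn : ∀ᵐ t ∂(volume : Measure ℝ), R ≤ t → g t < 0 → g' t ≤ 0 := by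
    rw [ae_restrict_iff' measurableSet_Ici] at hp heq
    filter_upwards [hp, heq] with t htp hte hRt hgt
    obtain ⟨hbg, hbb, hat, hRpt, hlν⟩ := hR t hRt
    have hwt := hpos t hat
    have hp1 := (htp hRpt).1
    have he := hte hat hwt
    have ht1 : 1 < t := by linarith
    have ht0 : 0 < t := by linarith
    have hl : 0 < Real.log t := Real.log_pos ht1
    have hht := hhpos t hRt
    have key := ptwise_aux B lam (t ^ s) (h t) (h' t) (w t ^ lam) (w t ^ (lam - 1)) M1
      (-deriv w t) (b t) (p t) t⁻¹ (deriv (deriv w) t) hlam hB (Real.rpow_pos_of_pos ht0 s)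
      hht (Real.rpow_pos_of_pos hwt _) (Real.rpow_nonneg hwt.le _)
      (Real.rpow_le_rpow hwt.le (hanti (mem_Ici.mpr le_rfl) (mem_Ici.mpr hat) hat) hl1.le)
      hbb ?_ (by linarith [(hsgn t hat).2]) (by simp only [hg] at hgt; linarith) ?_
      (by rw [neg_neg]; exact he) hbg
    · rw [neg_neg] at key
      exact key
    · refine le_trans (le_of_eq ?_) hp1
      simp only [hh, hk]
      rw [Real.rpow_sub_one ht0.ne']
      field_simp
    · have e1 : Real.log t ^ ν = Real.log t ^ (ν - 1) * Real.log t := by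
        rw [← Real.rpow_add_one hl.ne']; congr 1; ring
      have e2 : 0 ≤ k * t⁻¹ * t⁻¹ * Real.log t ^ (ν - 1) * (Real.log t + ν) := by
        have : 0 ≤ Real.log t + ν := by linarith [neg_abs_le ν]
        positivity
      simp only [hh, hh']
      rw [e1]
      have e3 : (t ^ 2)⁻¹ = t⁻¹ * t⁻¹ := by rw [sq, mul_inv]
      rw [e3]
      nlinarith
  have hbar := barrier_aux g g' R hgder hgint hgn
  have hglow : Tendsto (fun r => h r * w a ^ lam) atTop (nhds 0) := by
    have t2 := (tendsto_aux 0 ν (by norm_num)).const_mul (k * w a ^ lam)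
    rw [mul_zero] at t2
    refine t2.congr fun r => ?_
    simp only [hh]
    rw [zero_add, Real.rpow_neg_one]
    ring
  refine final_aux w lam ν k R hlam hν hkpos (by linarith) hw
    (fun r hr => hpos r (by linarith)) ?_
  intro r hr
  by_contra hcon
  have hgr : g r < 0 := by
    simp only [hg, hh]; push Not at hcon; linarith
  have hev := hglow.eventually_lt_const (by linarith : 0 < -g r)
  obtain ⟨x, hx1, hx2⟩ := (hev.and (eventually_ge_atTop r)).exists
  have h1 := hbar r hr hgr x hx2
  have hax : a ≤ x := by linarith
  have h2 : h x * w x ^ lam ≤ h x * w a ^ lam :=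
    mul_le_mul_of_nonneg_left (Real.rpow_le_rpow (hpos x hax).le
      (hanti (mem_Ici.mpr le_rfl) (mem_Ici.mpr hax) hax) (by linarith))
      (hhpos x (by linarith)).le
  have h3 := (hsgn x hax).2
  have h4 : g x = -deriv w x - h x * w x ^ lam := rfl
  linarith
end

section
/- Suppose λ < 1, s > −1 and ν < −1, where now p satisfies, for some constants c_1, c_2 > 0, c_1 r^{s−1} (log r)^ν ≤ p(r) ≤ c_2 r^{s−1} (log r)^ν for almost all sufficiently large r. Then there exists a constant C > 0, independent of the solution, such that every regular Kneser solution w of the second-order problem satisfies w(r) ≥ C (log r)^{(ν+1)/(1−λ)} for all sufficiently large r. -/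
open MeasureTheory Filter Set

/-- A function whose derivative is a.e. nonpositive where it is negative stays below a negative
initial value. -/
lemma aux_persist (D D' : ℝ → ℝ) (r0 : ℝ) (hd : ∀ x, r0 ≤ x → HasDerivAt D (D' x) x)
    (hint : ∀ x y, r0 ≤ x → x ≤ y → IntervalIntegrable D' volume x y)
    (hae : ∀ᵐ x ∂(volume.restrict (Ici r0)), D x < 0 → D' x ≤ 0) (h0 : D r0 < 0) :
    ∀ r, r0 ≤ r → D r ≤ D r0 := by
  intro r hr
  have hcont : ContinuousOn D (Icc r0 r) := fun x hx =>
    (hd x hx.1).continuousAt.continuousWithinAt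
  have hcl : IsClosed ({x | D x ≤ D r0} ∩ Icc r0 r) := by
    have := hcont.preimage_isClosed_of_isClosed isClosed_Icc (isClosed_Iic (a := D r0))
    rw [inter_comm]; exact this
  have := hcl.Icc_subset_of_forall_mem_nhdsWithin (le_refl (D r0)) (by
    rintro x ⟨hx, hx1, hx2⟩
    have hx' : D x < 0 := lt_of_le_of_lt hx h0
    have hev : ∀ᶠ y in nhds x, D y < 0 := (hd x hx1).continuousAt.eventually_lt_const hx'
    obtain ⟨δ, hδ, hball⟩ := Metric.eventually_nhds_iff.1 hev
    have : Ioo x (x + δ) ∈ nhdsWithin x (Ioi x) := Ioo_mem_nhdsGT (by linarith)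
    filter_upwards [this] with y hy
    have hxy : x ≤ y := hy.1.le
    have hFTC : ∫ t in x..y, D' t = D y - D x :=
      intervalIntegral.integral_eq_sub_of_hasDerivAt (fun t ht => by
        rw [uIcc_of_le hxy] at ht
        exact hd t (hx1.trans ht.1)) (hint x y hx1 hxy)
    have hle : ∫ t in x..y, D' t ≤ 0 := by
      rw [intervalIntegral.integral_of_le hxy]
      apply integral_nonpos_of_ae
      have h1 : ∀ᵐ t ∂(volume.restrict (Ioc x y)), D t < 0 → D' t ≤ 0 :=
        ae_restrict_of_ae_restrict_of_subset
          (fun t ht => (hx1.trans ht.1.le : r0 ≤ t)) hae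
      filter_upwards [h1, ae_restrict_mem measurableSet_Ioc] with t ht hmem
      apply ht
      apply hball
      rw [Real.dist_eq, abs_of_pos (by linarith [hmem.1])]
      linarith [hmem.2, hy.2]
    simp only [mem_ofPred_eq] at hx ⊢
    linarith)
  exact this ⟨hr, le_refl r⟩

/-- The pointwise algebraic inequality. -/
lemma aux_alg (B c ε S q q' m m' z w v v' θ : ℝ) (hB : 0 < B)
    (hε : 0 < ε) (hεB : ε * B ≤ c / 2) (hεc : ε * ε ≤ c) (hS : 0 < S) (hq : 0 < q)
    (hm : 0 < m) (hm' : m' ≤ 0) (hz : 0 < z) (hw : 0 < w) (hv : 0 ≤ v) (hθ : 0 < θ)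
    (hqm : q = S * m ^ 2) (hq' : 0 ≤ c / 2 * (S * q) + ε * q')
    (hv' : v' ≤ B * S * v - c * (S * q) * (w / z ^ 2))
    (hX : v * (z * (z + m) / w) - ε * q < 0) :
    v' * (z * (z + m) / w) + v * ((θ * (z / w * (-v)) * (z + m) + z * (θ * (z / w * (-v)) + m')) / w
      + z * (z + m) * v / w ^ 2) - ε * q' ≤ 0 := by
  set X := v * (z * (z + m) / w) with hXdef
  have hX0 : 0 ≤ X := by positivity
  have e1 : v' * (z * (z + m) / w) ≤ B * S * X - c * (S * q) * (1 + m / z) := by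
    have : B * S * X - c * (S * q) * (1 + m / z)
        = (B * S * v - c * (S * q) * (w / z ^ 2)) * (z * (z + m) / w) := by
      rw [hXdef]; field_simp
    rw [this]
    exact mul_le_mul_of_nonneg_right hv' (by positivity)
  have e2 : v * ((θ * (z / w * (-v)) * (z + m) + z * (θ * (z / w * (-v)) + m')) / w) ≤ 0 := by
    apply mul_nonpos_of_nonneg_of_nonpos hv
    apply div_nonpos_of_nonpos_of_nonneg _ hw.le
    have h1 : 0 ≤ θ * (z / w * v) := by positivity
    have h2 : 0 ≤ θ * (z / w * v) * (z + m) := by positivity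
    have h3 : 0 ≤ z * (θ * (z / w * v)) := by positivity
    have h4 : 0 ≤ z * (-m') := mul_nonneg hz.le (by linarith)
    nlinarith
  have e3 : v * (z * (z + m) * v / w ^ 2) ≤ ε * ε * (S * q) * (m / z) := by
    have h1 : v * (z * (z + m) * v / w ^ 2) = X * X / (z * (z + m)) := by
      rw [hXdef]; field_simp
    have h2 : X * X ≤ (ε * q) * (ε * q) := by
      apply mul_le_mul <;> first | linarith
    rw [h1, div_le_iff₀ (by positivity)]
    have h3 : ε * ε * (S * q) * (m / z) * (z * (z + m)) = ε * ε * q * (S * m * z + S * m ^ 2) := by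
      field_simp
    rw [h3, ← hqm]
    have h4 : 0 ≤ ε * ε * q * (S * m * z) := by positivity
    nlinarith
  have e4 : B * S * X ≤ c / 2 * (S * q) := by
    have : B * S * X ≤ B * S * (ε * q) := mul_le_mul_of_nonneg_left (by linarith) (by positivity)
    have h2 : (ε * B) * (S * q) ≤ c / 2 * (S * q) :=
      mul_le_mul_of_nonneg_right hεB (by positivity)
    nlinarith
  have e5 : ε * ε * (S * q) * (m / z) ≤ c * (S * q) * (m / z) := by
    gcongr
  rw [mul_add v]
  linarith

/-- The core lower estimate of the derivative. -/
lemma aux_core (a lam B c ε R θ : ℝ) (b p S q q' m m' w : ℝ → ℝ)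
    (hB : 0 < B)
    (hε : 0 < ε) (hεB : ε * B ≤ c / 2) (hεc : ε * ε ≤ c) (hθ : 0 < θ) (hlamθ : lam = 1 - 2 * θ)
    (haR : a ≤ R)
    (hS : ∀ r, R ≤ r → 0 < S r) (hq : ∀ r, R ≤ r → 0 < q r) (hm : ∀ r, R ≤ r → 0 < m r)
    (hm' : ∀ r, R ≤ r → m' r ≤ 0) (hqm : ∀ r, R ≤ r → q r = S r * m r ^ 2)
    (hq' : ∀ r, R ≤ r → 0 ≤ c / 2 * (S r * q r) + ε * q' r)
    (hdm : ∀ r, R ≤ r → HasDerivAt m (m' r) r) (hdq : ∀ r, R ≤ r → HasDerivAt q (q' r) r)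
    (hcm : ContinuousOn m' (Ici R)) (hcq : ContinuousOn q' (Ici R))
    (hq0 : Tendsto q atTop (nhds 0))
    (hb : ∀ r, R ≤ r → |b r| ≤ B * S r)
    (hp : ∀ᵐ r ∂(volume.restrict (Ici R)), c * (S r * q r) ≤ p r)
    (hw : IsKneser2 a b p (fun t => t ^ lam) w) (hpos : ∀ r, a ≤ r → 0 < w r) :
    ∀ r, R ≤ r → ε * q r ≤ -deriv w r * (w r ^ θ * (w r ^ θ + m r) / w r) := by
  obtain ⟨hw1, hw2, hint, -, -, hsign, hae⟩ := hw
  have hposR : ∀ r, R ≤ r → 0 < w r := fun r hr => hpos r (haR.trans hr)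
  set D : ℝ → ℝ := fun r => -deriv w r * (w r ^ θ * (w r ^ θ + m r) / w r) - ε * q r with hD
  set k' : ℝ → ℝ := fun r => (θ * (w r ^ θ / w r * (-(-deriv w r))) * (w r ^ θ + m r)
      + w r ^ θ * (θ * (w r ^ θ / w r * (-(-deriv w r))) + m' r)) / w r
      + w r ^ θ * (w r ^ θ + m r) * (-deriv w r) / w r ^ 2 with hk'
  set D' : ℝ → ℝ := fun r => -deriv (deriv w) r * (w r ^ θ * (w r ^ θ + m r) / w r)
      + -deriv w r * k' r - ε * q' r with hD'
  have hz : ∀ r, R ≤ r → HasDerivAt (fun x => w x ^ θ) (θ * (w r ^ θ / w r * deriv w r)) r := by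
    intro r hr
    have h := (hw1 r).hasDerivAt.rpow_const (p := θ) (Or.inl (hposR r hr).ne')
    convert h using 1
    rw [Real.rpow_sub_one (hposR r hr).ne']; ring
  have hdD : ∀ x, R ≤ x → HasDerivAt D (D' x) x := by
    intro r hr
    have hwr := hposR r hr
    have h1 := (hz r hr).mul ((hz r hr).add (hdm r hr))
    have h2 := h1.div (hw1 r).hasDerivAt hwr.ne'
    have h3 := ((hw2 r).hasDerivAt.neg.mul h2).sub ((hdq r hr).const_mul ε)
    refine HasDerivAt.congr_deriv (f := D) h3 ?_
    simp only [hD', hk', neg_neg, Pi.add_apply, Pi.mul_apply, Pi.neg_apply, Pi.div_apply]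
    have : w r ≠ 0 := hwr.ne'
    field_simp
    ring
  have hcw : ContinuousOn w (Ici R) := hw1.continuous.continuousOn
  have hcw' : ContinuousOn (deriv w) (Ici R) := hw2.continuous.continuousOn
  have hcmm : ContinuousOn m (Ici R) := fun x hx => (hdm x hx).continuousAt.continuousWithinAt
  have hcz : ContinuousOn (fun r => w r ^ θ) (Ici R) :=
    hcw.rpow_const (fun x hx => Or.inl (hposR x hx).ne')
  have hne : ∀ x ∈ Ici R, w x ≠ 0 := fun x hx => (hposR x hx).ne'
  have hck : ContinuousOn (fun r => w r ^ θ * (w r ^ θ + m r) / w r) (Ici R) :=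
    (hcz.mul (hcz.add hcmm)).div hcw hne
  have hczw : ContinuousOn (fun r => θ * (w r ^ θ / w r * (-(-deriv w r)))) (Ici R) :=
    continuousOn_const.mul ((hcz.div hcw hne).mul hcw'.neg.neg)
  have hck' : ContinuousOn k' (Ici R) := by
    refine ContinuousOn.add (ContinuousOn.div (ContinuousOn.add (hczw.mul (hcz.add hcmm))
      (hcz.mul (hczw.add hcm))) hcw hne) (ContinuousOn.div ((hcz.mul (hcz.add hcmm)).mul hcw'.neg)
      (hcw.pow 2) (fun x hx => pow_ne_zero 2 (hne x hx)))
  have hDint : ∀ x y, R ≤ x → x ≤ y → IntervalIntegrable D' volume x y := by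
    intro x y hx hxy
    have hsub : uIcc x y ⊆ Ici R := by
      rw [uIcc_of_le hxy]; intro t ht; exact hx.trans ht.1
    have h1 : IntervalIntegrable (deriv (deriv w)) volume x y :=
      (hint x (haR.trans hx)).symm.trans (hint y (haR.trans (hx.trans hxy)))
    have h2 := h1.neg.mul_continuousOn (hck.mono hsub)
    have h3 := ((hcw'.neg.mul hck').mono hsub).intervalIntegrable (μ := volume)
    have h4 := ((continuousOn_const (c := ε)).mul hcq |>.mono hsub).intervalIntegrable (μ := volume)
    exact (h2.add h3).sub h4
  have hDae : ∀ᵐ x ∂(volume.restrict (Ici R)), D x < 0 → D' x ≤ 0 := by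
    have h1 := ae_restrict_of_ae_restrict_of_subset (Ici_subset_Ici.2 haR) hae
    filter_upwards [h1, hp, ae_restrict_mem measurableSet_Ici] with r he hpr hr hneg
    have hwr := hposR r hr
    have hr' : R ≤ r := hr
    have hv : 0 ≤ -deriv w r := by linarith [(hsign r (haR.trans hr')).2]
    have he := he hwr
    have hzp : 0 < w r ^ θ := Real.rpow_pos_of_pos hwr θ
    refine aux_alg B c ε (S r) (q r) (q' r) (m r) (m' r) (w r ^ θ) (w r) (-deriv w r)
      (-deriv (deriv w) r) θ hB hε hεB hεc (hS r hr') (hq r hr') (hm r hr') (hm' r hr') hzp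
      hwr hv hθ (hqm r hr') (hq' r hr') ?_ hneg
    have hwl : w r ^ lam = w r / (w r ^ θ) ^ 2 := by
      rw [hlamθ, Real.rpow_sub hwr, Real.rpow_one, ← Real.rpow_mul_natCast hwr.le]
      congr 2; push_cast; ring
    rw [hwl] at he
    have h5 : c * (S r * q r) * (w r / (w r ^ θ) ^ 2) ≤ p r * (w r / (w r ^ θ) ^ 2) :=
      mul_le_mul_of_nonneg_right hpr (by positivity)
    have h6 : -b r * (-deriv w r) ≤ B * S r * (-deriv w r) :=
      mul_le_mul_of_nonneg_right ((neg_le_abs _).trans (hb r hr')) hv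
    nlinarith
  intro r hr
  by_contra hcon
  push Not at hcon
  have h0 : D r < 0 := by simp only [hD]; linarith
  have hper := aux_persist D D' r (fun x hx => hdD x (hr.trans hx))
    (fun x y hx hxy => hDint x y (hr.trans hx) hxy)
    (ae_restrict_of_ae_restrict_of_subset (Ici_subset_Ici.2 hr) hDae) h0
  have hlim : Tendsto (fun x => ε * q x) atTop (nhds 0) := by simpa using hq0.const_mul ε
  have hev : ∀ᶠ x in atTop, ε * q x < -D r := hlim.eventually_lt_const (by linarith)
  obtain ⟨x, hx1, hx2⟩ := (hev.and (eventually_ge_atTop r)).exists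
  have h7 := hper x hx2
  have h8 : 0 ≤ -deriv w x * (w x ^ θ * (w x ^ θ + m x) / w x) := by
    have hxR := hr.trans hx2
    have hwx := hposR x hxR
    have hmx := hm x hxR
    have : 0 ≤ -deriv w x := by linarith [(hsign x (haR.trans hxR)).2]
    positivity
  simp only [hD] at h7 hx1
  linarith

/-- Integrated version. -/
lemma aux_final (R θ ε : ℝ) (q m m' M w : ℝ → ℝ) (hθ : 0 < θ)
    (hw1 : Differentiable ℝ w) (hpos : ∀ r, R ≤ r → 0 < w r)
    (hm : ∀ r, R ≤ r → 0 < m r)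
    (hm' : ∀ r, R ≤ r → m' r ≤ 0)
    (hdm : ∀ r, R ≤ r → HasDerivAt m (m' r) r)
    (hdM : ∀ r, R ≤ r → HasDerivAt M (-(θ * ε * q r)) r)
    (hM0 : Tendsto M atTop (nhds 0))
    (hMm : ∀ r, R ≤ r → m r ^ 2 ≤ M r)
    (hcore : ∀ r, R ≤ r → ε * q r ≤ -deriv w r * (w r ^ θ * (w r ^ θ + m r) / w r)) :
    ∀ r, R ≤ r → M r / 2 ≤ (w r ^ θ) ^ 2 := by
  set Y : ℝ → ℝ := fun r => (w r ^ θ) ^ 2 / 2 + m r * w r ^ θ - M r with hY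
  have hz : ∀ r, R ≤ r → HasDerivAt (fun x => w x ^ θ) (θ * (w r ^ θ / w r * deriv w r)) r := by
    intro r hr
    have h := (hw1 r).hasDerivAt.rpow_const (p := θ) (Or.inl (hpos r hr).ne')
    convert h using 1
    rw [Real.rpow_sub_one (hpos r hr).ne']; ring
  have hdY : ∀ r, R ≤ r → HasDerivAt Y (-(θ * (-deriv w r * (w r ^ θ * (w r ^ θ + m r) / w r)
      - ε * q r)) + m' r * w r ^ θ) r := by
    intro r hr
    have h := ((((hz r hr).pow 2).div_const 2).add ((hdm r hr).mul (hz r hr))).sub (hdM r hr)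
    refine HasDerivAt.congr_deriv (f := Y) h ?_
    push_cast
    ring
  have hanti : AntitoneOn Y (Ici R) := by
    apply antitoneOn_of_deriv_nonpos (convex_Ici R)
    · exact fun x hx => (hdY x hx).continuousAt.continuousWithinAt
    · intro x hx
      rw [interior_Ici] at hx
      exact (hdY x (le_of_lt hx)).differentiableAt.differentiableWithinAt
    · intro x hx
      rw [interior_Ici] at hx
      have hx' : R ≤ x := le_of_lt hx
      rw [(hdY x hx').deriv]
      have h1 := hcore x hx'
      have h2 : m' x * w x ^ θ ≤ 0 :=
        mul_nonpos_of_nonpos_of_nonneg (hm' x hx') (Real.rpow_pos_of_pos (hpos x hx') θ).le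
      have h3 : 0 ≤ θ * (-deriv w x * (w x ^ θ * (w x ^ θ + m x) / w x) - ε * q x) :=
        mul_nonneg hθ.le (by linarith)
      linarith
  intro r hr
  have hYr : 0 ≤ Y r := by
    have hlim : Tendsto (fun x => -M x) atTop (nhds 0) := by simpa using hM0.neg
    apply le_of_tendsto hlim
    filter_upwards [eventually_ge_atTop r] with x hx
    have h1 := hanti (mem_Ici.2 hr) (mem_Ici.2 (hr.trans hx)) hx
    have h2 : -M x ≤ Y x := by
      have := hm x (hr.trans hx)
      have := Real.rpow_pos_of_pos (hpos x (hr.trans hx)) θ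
      have : 0 ≤ (w x ^ θ) ^ 2 / 2 + m x * w x ^ θ := by positivity
      simp only [hY]; linarith
    linarith
  have := hMm r hr
  simp only [hY] at hYr
  nlinarith [sq_nonneg (m r - w r ^ θ)]

/-- Example 2.5 (lower estimate, case `s > -1`): if `λ < 1`, `s > -1`, `ν < -1`,
`|b(r)| ≤ B r^s` for large `r` and `p(r) ∼ r^{s-1} log^ν r` at infinity, then there is
`C > 0`, independent of the solution, such that every regular Kneser solution of
`w'' + b(r) w' = p(r) w^λ` satisfies `w(r) ≥ C (log r)^{(ν+1)/(1-λ)}` for all sufficiently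
large `r`. -/
theorem second_order_log_lower_estimate
    (a lam s ν B : ℝ) (ha : 1 < a) (hlam : lam < 1) (hs : -1 < s) (hν : ν < -1)
    (hB : 0 < B) (b p : ℝ → ℝ) (hb_meas : Measurable b) (hp_meas : Measurable p)
    (hb_loc : ∀ r, ∃ M, ∀ x ∈ Icc a r, |b x| ≤ M)
    (hp_loc : ∀ r, ∃ M, ∀ x ∈ Icc a r, |p x| ≤ M)
    (hp_nonneg : ∀ r, a ≤ r → 0 ≤ p r)
    (hb_bound : ∀ᶠ r in atTop, |b r| ≤ B * r ^ s)
    (hp_sim : ∃ c₁ > (0 : ℝ), ∃ c₂ > (0 : ℝ), ∃ R : ℝ,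
      ∀ᵐ r ∂(volume.restrict (Ici R)),
        c₁ * r ^ (s - 1) * Real.log r ^ ν ≤ p r ∧ p r ≤ c₂ * r ^ (s - 1) * Real.log r ^ ν) :
    ∃ C, 0 < C ∧ ∀ w : ℝ → ℝ, IsKneser2 a b p (fun t => t ^ lam) w →
      (∀ r, a ≤ r → 0 < w r) →
      ∀ᶠ r in atTop, C * Real.log r ^ ((ν + 1) / (1 - lam)) ≤ w r := by
  obtain ⟨c, hc, c₂, -, R₁, hp⟩ := hp_sim
  set ε : ℝ := min (min 1 c) (c / (2 * B)) with hεdef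
  have hε : 0 < ε := by positivity
  have hε1 : ε ≤ 1 := (min_le_left _ _).trans (min_le_left _ _)
  have hεc' : ε ≤ c := (min_le_left _ _).trans (min_le_right _ _)
  have hεc : ε * ε ≤ c := by nlinarith
  have hεB : ε * B ≤ c / 2 := by
    have h : ε ≤ c / (2 * B) := min_le_right _ _
    rw [le_div_iff₀ (by positivity)] at h
    linarith
  set θ : ℝ := (1 - lam) / 2 with hθdef
  have hθ : 0 < θ := by rw [hθdef]; linarith
  have hlamθ : lam = 1 - 2 * θ := by rw [hθdef]; ring
  set κ : ℝ := θ * ε / (-(ν + 1)) with hκdef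
  have hν1 : 0 < -(ν + 1) := by linarith
  have hκ : 0 < κ := by positivity
  have hκν : κ * (ν + 1) = -(θ * ε) := by
    have hne : ν + 1 ≠ 0 := by linarith
    rw [hκdef, div_neg, neg_mul, div_mul_cancel₀ _ hne]
  have hlog : Tendsto Real.log atTop atTop := Real.tendsto_log_atTop
  have hev : ∀ᶠ r : ℝ in atTop, a ≤ r ∧ R₁ ≤ r ∧ 1 ≤ Real.log r ∧ |b r| ≤ B * r ^ s ∧
      2 * ε * (1 - ν) / c ≤ r ^ (1 + s) ∧ r ^ (-(1 + s)) ≤ κ := by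
    refine (eventually_ge_atTop a).and ((eventually_ge_atTop R₁).and
      ((hlog.eventually_ge_atTop 1).and (hb_bound.and
      (((tendsto_rpow_atTop (by linarith)).eventually_ge_atTop _).and ?_))))
    exact (tendsto_rpow_neg_atTop (by linarith)).eventually_le_const hκ
  obtain ⟨R, hR⟩ := eventually_atTop.1 hev
  have haR : a ≤ R := (hR R le_rfl).1
  have hr0 : ∀ r, R ≤ r → 0 < r := fun r hr => by linarith [(hR r hr).1]
  have hL1 : ∀ r, R ≤ r → 1 ≤ Real.log r := fun r hr => (hR r hr).2.2.1
  have hL0 : ∀ r, R ≤ r → 0 < Real.log r := fun r hr => by linarith [hL1 r hr]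
  set S : ℝ → ℝ := fun r => r ^ s with hSdef
  set q : ℝ → ℝ := fun r => r⁻¹ * Real.log r ^ ν with hqdef
  set q' : ℝ → ℝ := fun r => -(r ^ 2)⁻¹ * Real.log r ^ ν
    + r⁻¹ * (r⁻¹ * ν * Real.log r ^ (ν - 1)) with hq'def
  set m : ℝ → ℝ := fun r => r ^ (-(1 + s) / 2) * Real.log r ^ (ν / 2) with hmdef
  set m' : ℝ → ℝ := fun r => (1 * (-(1 + s) / 2) * r ^ (-(1 + s) / 2 - 1)) * Real.log r ^ (ν / 2)
    + r ^ (-(1 + s) / 2) * (r⁻¹ * (ν / 2) * Real.log r ^ (ν / 2 - 1)) with hm'def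
  set M : ℝ → ℝ := fun r => κ * Real.log r ^ (ν + 1) with hMdef
  have hlogd : ∀ (e r : ℝ), R ≤ r → HasDerivAt (fun x => Real.log x ^ e)
      (r⁻¹ * e * Real.log r ^ (e - 1)) r := fun e r hr =>
    (Real.hasDerivAt_log (hr0 r hr).ne').rpow_const (Or.inl (hL0 r hr).ne')
  have hlc : ∀ e : ℝ, ContinuousOn (fun x => Real.log x ^ e) (Ici R) := fun e x hx =>
    (hlogd e x hx).continuousAt.continuousWithinAt
  have hrc : ∀ e : ℝ, ContinuousOn (fun x : ℝ => x ^ e) (Ici R) := fun e x hx =>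
    (Real.continuousAt_rpow_const x e (Or.inl (hr0 x hx).ne')).continuousWithinAt
  have hic : ContinuousOn (fun x : ℝ => x⁻¹) (Ici R) :=
    continuousOn_id.inv₀ (fun x hx => (hr0 x hx).ne')
  have hS : ∀ r, R ≤ r → 0 < S r := fun r hr => Real.rpow_pos_of_pos (hr0 r hr) _
  have hq : ∀ r, R ≤ r → 0 < q r := fun r hr =>
    mul_pos (inv_pos.2 (hr0 r hr)) (Real.rpow_pos_of_pos (hL0 r hr) _)
  have hm : ∀ r, R ≤ r → 0 < m r := fun r hr =>
    mul_pos (Real.rpow_pos_of_pos (hr0 r hr) _) (Real.rpow_pos_of_pos (hL0 r hr) _)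
  have hm' : ∀ r, R ≤ r → m' r ≤ 0 := by
    intro r hr
    have h0 := hr0 r hr
    have hl := hL0 r hr
    have h1 : 0 < r ^ (-(1 + s) / 2 - 1) * Real.log r ^ (ν / 2) := by positivity
    have h2 : 0 < r ^ (-(1 + s) / 2) * (r⁻¹ * Real.log r ^ (ν / 2 - 1)) := by positivity
    have h3 : m' r = (-(1 + s) / 2) * (r ^ (-(1 + s) / 2 - 1) * Real.log r ^ (ν / 2))
      + (ν / 2) * (r ^ (-(1 + s) / 2) * (r⁻¹ * Real.log r ^ (ν / 2 - 1))) := by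
      rw [hm'def]; ring
    rw [h3]
    have h4 := mul_nonpos_of_nonpos_of_nonneg (by linarith : -(1 + s) / 2 ≤ 0) h1.le
    have h5 := mul_nonpos_of_nonpos_of_nonneg (by linarith : ν / 2 ≤ 0) h2.le
    linarith
  have hm2 : ∀ r, R ≤ r → m r ^ 2 = r ^ (-(1 + s)) * Real.log r ^ ν := by
    intro r hr
    rw [hmdef]
    simp only
    rw [mul_pow, ← Real.rpow_mul_natCast (hr0 r hr).le, ← Real.rpow_mul_natCast (hL0 r hr).le]
    congr 2 <;> push_cast <;> ring
  have hqm : ∀ r, R ≤ r → q r = S r * m r ^ 2 := by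
    intro r hr
    rw [hm2 r hr, hqdef, hSdef]
    simp only
    rw [← mul_assoc, ← Real.rpow_add (hr0 r hr), show s + -(1 + s) = -1 by ring, Real.rpow_neg_one]
  have hq' : ∀ r, R ≤ r → 0 ≤ c / 2 * (S r * q r) + ε * q' r := by
    intro r hr
    have h0 := hr0 r hr
    have hl := hL0 r hr
    have hle : Real.log r ^ (ν - 1) ≤ Real.log r ^ ν :=
      Real.rpow_le_rpow_of_exponent_le (hL1 r hr) (by linarith)
    have hbig := (hR r hr).2.2.2.2.1
    rw [div_le_iff₀ hc, Real.rpow_add h0, Real.rpow_one] at hbig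
    have hP : 0 < Real.log r ^ ν := by positivity
    have e1 : c / 2 * (S r * q r) + ε * q' r = (r⁻¹ * r⁻¹) * ((c / 2 * (r * r ^ s)) * Real.log r ^ ν
        - ε * Real.log r ^ ν + ε * ν * Real.log r ^ (ν - 1)) := by
      rw [hq'def, hSdef, hqdef]; field_simp; ring
    rw [e1]
    apply mul_nonneg (by positivity)
    have e2 : ε * (1 - ν) * Real.log r ^ ν ≤ (c / 2 * (r * r ^ s)) * Real.log r ^ ν :=
      mul_le_mul_of_nonneg_right (by linarith) hP.le
    have e3 : (ε * -ν) * Real.log r ^ (ν - 1) ≤ (ε * -ν) * Real.log r ^ ν :=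
      mul_le_mul_of_nonneg_left hle (mul_nonneg hε.le (by linarith))
    nlinarith
  have hdm : ∀ r, R ≤ r → HasDerivAt m (m' r) r := fun r hr =>
    ((hasDerivAt_id r).rpow_const (Or.inl (hr0 r hr).ne')).mul (hlogd _ r hr)
  have hdq : ∀ r, R ≤ r → HasDerivAt q (q' r) r := fun r hr =>
    (hasDerivAt_inv (hr0 r hr).ne').mul (hlogd _ r hr)
  have hcm : ContinuousOn m' (Ici R) :=
    ((continuousOn_const.mul (hrc _)).mul (hlc _)).add
      ((hrc _).mul ((hic.mul continuousOn_const).mul (hlc _)))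
  have hcq : ContinuousOn q' (Ici R) :=
    ((((continuousOn_id.pow 2).inv₀ (fun x hx => pow_ne_zero 2 (hr0 x hx).ne')).neg).mul
      (hlc _)).add (hic.mul ((hic.mul continuousOn_const).mul (hlc _)))
  have hlog0 : ∀ e : ℝ, e < 0 → Tendsto (fun r => Real.log r ^ e) atTop (nhds 0) := by
    intro e he
    have h := (tendsto_rpow_neg_atTop (y := -e) (by linarith)).comp hlog
    simpa [Function.comp_def] using h
  have hq0 : Tendsto q atTop (nhds 0) := by
    simpa using tendsto_inv_atTop_zero.mul (hlog0 ν (by linarith))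
  have hM0 : Tendsto M atTop (nhds 0) := by
    simpa using (hlog0 (ν + 1) (by linarith)).const_mul κ
  have hMm : ∀ r, R ≤ r → m r ^ 2 ≤ M r := by
    intro r hr
    rw [hm2 r hr]
    have h0 := hr0 r hr
    have hl := hL0 r hr
    exact mul_le_mul (hR r hr).2.2.2.2.2
      (Real.rpow_le_rpow_of_exponent_le (hL1 r hr) (by linarith)) (by positivity) hκ.le
  have hdM : ∀ r, R ≤ r → HasDerivAt M (-(θ * ε * q r)) r := by
    intro r hr
    refine HasDerivAt.congr_deriv (f := M) ((hlogd (ν + 1) r hr).const_mul κ) ?_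
    rw [add_sub_cancel_right, hqdef]
    linear_combination r⁻¹ * Real.log r ^ ν * hκν
  have hb : ∀ r, R ≤ r → |b r| ≤ B * S r := fun r hr => (hR r hr).2.2.2.1
  have hp' : ∀ᵐ r ∂(volume.restrict (Ici R)), c * (S r * q r) ≤ p r := by
    have h1 := ae_restrict_of_ae_restrict_of_subset
      (Ici_subset_Ici.2 (hR R le_rfl).2.1) hp
    filter_upwards [h1, ae_restrict_mem measurableSet_Ici] with r h hr
    refine le_trans (le_of_eq ?_) h.1
    rw [Real.rpow_sub_one (hr0 r hr).ne', hSdef, hqdef]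
    simp only
    ring
  refine ⟨(κ / 2) ^ (1 / (1 - lam)), by positivity, fun w hw hpos => ?_⟩
  have hcore := aux_core a lam B c ε R θ b p S q q' m m' w hB hε hεB hεc hθ hlamθ haR hS hq hm hm'
    hqm hq' hdm hdq hcm hcq hq0 hb hp' hw hpos
  have hposR : ∀ r, R ≤ r → 0 < w r := fun r hr => hpos r (haR.trans hr)
  have hfin := aux_final R θ ε q m m' M w hθ hw.1 hposR hm hm' hdm hdM hM0 hMm hcore
  filter_upwards [eventually_ge_atTop R] with r hr
  have h := hfin r hr
  have hwr := hposR r hr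
  have hl := hL0 r hr
  have h1l : 0 < 1 - lam := by linarith
  have e1 : (w r ^ θ) ^ 2 = w r ^ (1 - lam) := by
    rw [← Real.rpow_mul_natCast hwr.le]
    congr 1; rw [hθdef]; push_cast; ring
  have e2 : M r / 2 = κ / 2 * Real.log r ^ (ν + 1) := by rw [hMdef]; ring
  rw [e1, e2] at h
  have h2 := Real.rpow_le_rpow (by positivity) h (z := 1 / (1 - lam)) (by positivity)
  rw [Real.mul_rpow (by positivity) (by positivity), ← Real.rpow_mul hl.le,
    ← Real.rpow_mul hwr.le, mul_one_div, mul_one_div, div_self h1l.ne', Real.rpow_one] at h2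
  exact h2
end
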